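/- Suppose p > 0, (H1), and let (λ_n, μ_n, u_n) be a sequence of solutions of (q) with μ_n → ∞. Define U_β(r) = (β·log(1/r))^{1/p}. Set β ∈ (0, 4/p) if 0 < p ≤ 2 and β ∈ (0, 2) if p > 2. Then, up to a subsequence, Z_{(0, r_{0,n}]}[u_n − U_β] ≥ 1 for all large n. Moreover: (i) if 0 < p < 1 then for any β ≥ p/4, choosing δ ∈ (0,1) with 4δ^{p−1}/p = β, there is a sequence (r_n) ⊂ (0,1) with u_n(r_n)/μ_n → δ, u_n(r_n) = U_β(r_n), and Z_{(0, r_n]}[u_n − U_β] ≥ 1 for all large n; (ii) if 1 < p ≤ 2 then for every 0 < β < 4/p, choosing δ ∈ (0,1) with 4δ^{p−1}/p = β, there is a sequence (r_n) ⊂ (r_{0,n}, 1) with u_n(r_n)/μ_n → δ, u_n(r_n) = U_β(r_n), and Z_{(0, r_n]}[u_n − U_β] ≥ 2 for all large n; (iii) if p > 2 and k ∈ ℕ ∪ {0}, then for each β ∈ (β_k*, 2), taking δ_k > δ > δ_k* > δ' > δ_{k+1} with β_k(δ) = β_k(δ') = β, there exist sequences (r_n), (r_n') ⊂ (r_{k,n},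 r_{k+1,n}) with u_n(r_n)/μ_n → δ, u_n(r_n')/μ_n → δ', u_n(r_n) = U_β(r_n), u_n(r_n') = U_β(r_n'), and Z_{(0, r_n']}[u_n − U_β] ≥ 1 + 2(k+1) for all large n. -/

import Mathlib

open Filter

/-- The bubble sequences `(a_k)`, `(δ_k)` for `p > 2`. -/
def IsBubbleSeq (p : ℝ) (a δ : ℕ → ℝ) : Prop :=
  a 0 = 2 ∧ δ 0 = 1 ∧
  ∀ k : ℕ,
    δ (k + 1) ∈ Set.Ioo 0 (δ k) ∧
    2 * p / (2 + a k) * (1 - δ (k + 1) / δ k) - 1 + (δ (k + 1) / δ k) ^ p = 0 ∧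
    a (k + 1) = 2 - (δ (k + 1) / δ k) ^ (p - 1) * (2 + a k) ∧
    a (k + 1) ∈ Set.Ioo (0:ℝ) 2

/-- The singular comparison function `U_β(r) = (β log (1/r))^{1/p}`. -/
noncomputable def Ubeta (p β : ℝ) (r : ℝ) : ℝ := (β * Real.log (1 / r)) ^ (1 / p)

/-- `v` has at least `N` zeros on the set `I`. -/
def ZeroCountAtLeast (I : Set ℝ) (v : ℝ → ℝ) (N : ℕ) : Prop :=
  ∃ S : Finset ℝ, ↑S ⊆ {x ∈ I | v x = 0} ∧ N ≤ S.card

section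
open Set Topology

/-- The mean value theorem on `[a, b] ⊆ (0, ∞)`. -/
lemma exists_sub_eq_mul_of_pos {f f' : ℝ → ℝ} {a b : ℝ} (ha : 0 < a) (hab : a < b)
    (hf : ∀ s, 0 < s → HasDerivAt f (f' s) s) :
    ∃ c ∈ Ioo a b, f b - f a = (b - a) * f' c := by
  obtain ⟨c, hc, h⟩ := exists_hasDerivAt_eq_slope f f' hab
    (fun x hx => (hf x (ha.trans_le hx.1)).continuousAt.continuousWithinAt)
    (fun x hx => hf x (ha.trans hx.1))
  refine ⟨c, hc, ?_⟩
  rw [h]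
  field_simp [(sub_pos.2 hab).ne']

/-- Bounded real sequences converge along ultrafilters. -/
lemma Ultrafilter.exists_tendsto_of_mem_Icc {ι : Type*} (F : Ultrafilter ι) {x : ι → ℝ} {a b : ℝ}
    (hx : ∀ᶠ n in (F : Filter ι), x n ∈ Icc a b) :
    ∃ y ∈ Icc a b, Tendsto x F (𝓝 y) := by
  obtain ⟨y, hy, h⟩ := (isCompact_Icc (a := a) (b := b)).ultrafilter_le_nhds (F.map x)
    (by rw [le_principal_iff]; exact hx)
  exact ⟨y, hy, h⟩

/-- A sequence of rescaled solutions `w n` in the variable `s = log (1/r) / M n`, with derivative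
`v n`, concave with second derivative `-G n`, together with the growth law of `G n` and
the location `s₀` of the first concentration. -/
structure IsRescaledSeq (p s₀ : ℝ) (M : ℕ → ℝ) (w v G Q : ℕ → ℝ → ℝ) : Prop where
  tendsto_M : Tendsto M atTop atTop
  hasDerivAt_w : ∀ n s, 0 < s → HasDerivAt (w n) (v n s) s
  hasDerivAt_v : ∀ n s, 0 < s → HasDerivAt (v n) (-(G n s)) s
  G_nonneg : ∀ n s, 0 < s → 0 ≤ G n s
  v_nonneg : ∀ n s, 0 < s → 0 ≤ v n s
  w_pos : ∀ n s, 0 < s → 0 < w n s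
  w_le_one : ∀ n s, 0 < s → w n s ≤ 1
  mul_v_le : ∀ n s, 0 < s → s * v n s ≤ w n s
  hasDerivAt_G : ∀ η, 0 < η → ∀ᶠ n in atTop, ∀ s, 0 < s → η ≤ w n s →
    0 < G n s ∧ HasDerivAt (G n) (M n * G n s * (Q n s * v n s - 2)) s
  abs_Q_sub_le : ∀ ε, 0 < ε → ∀ η, 0 < η → ∀ᶠ n in atTop, ∀ s, 0 < s → η ≤ w n s →
    |Q n s - p * w n s ^ (p - 1)| ≤ ε
  s₀_pos : 0 < s₀
  exists_center : ∃ σ : ℕ → ℝ, Tendsto σ atTop (𝓝 s₀) ∧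
    Tendsto (fun n => w n (σ n)) atTop (𝓝 1) ∧
    Tendsto (fun n => Real.log (G n (σ n)) / M n) atTop (𝓝 0)

namespace IsRescaledSeq

variable {p s₀ : ℝ} {M : ℕ → ℝ} {w v G Q : ℕ → ℝ → ℝ}

lemma w_mono (hR : IsRescaledSeq p s₀ M w v G Q) (n : ℕ) {a b : ℝ} (ha : 0 < a) (hab : a ≤ b) :
    w n a ≤ w n b := by
  rcases hab.eq_or_lt with rfl | hab
  · exact le_rfl
  obtain ⟨c, hc, h⟩ := exists_sub_eq_mul_of_pos ha hab (hR.hasDerivAt_w n)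
  nlinarith [hR.v_nonneg n c (ha.trans hc.1)]

lemma v_anti (hR : IsRescaledSeq p s₀ M w v G Q) (n : ℕ) {a b : ℝ} (ha : 0 < a) (hab : a ≤ b) :
    v n b ≤ v n a := by
  rcases hab.eq_or_lt with rfl | hab
  · exact le_rfl
  obtain ⟨c, hc, h⟩ := exists_sub_eq_mul_of_pos ha hab (hR.hasDerivAt_v n)
  nlinarith [hR.G_nonneg n c (ha.trans hc.1)]

lemma mul_v_le_sub (hR : IsRescaledSeq p s₀ M w v G Q) (n : ℕ) {a b : ℝ} (ha : 0 < a)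
    (hab : a ≤ b) :
    (b - a) * v n b ≤ w n b - w n a ∧ w n b - w n a ≤ (b - a) * v n a := by
  rcases hab.eq_or_lt with rfl | hab
  · simp
  obtain ⟨c, hc, h⟩ := exists_sub_eq_mul_of_pos ha hab (hR.hasDerivAt_w n)
  rw [h]
  have h1 := hR.v_anti n ha hc.1.le
  have h2 := hR.v_anti n (ha.trans hc.1) hc.2.le
  constructor <;> nlinarith

lemma v_le (hR : IsRescaledSeq p s₀ M w v G Q) (n : ℕ) {a s : ℝ} (ha : 0 < a) (has : a ≤ s) :
    v n s ≤ 1 / a := by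
  rw [le_div_iff₀ ha]
  have hs := ha.trans_le has
  nlinarith [hR.mul_v_le n s hs, hR.w_le_one n s hs, hR.v_nonneg n s hs]

lemma abs_w_sub_le (hR : IsRescaledSeq p s₀ M w v G Q) (n : ℕ) {a x y : ℝ} (ha : 0 < a)
    (hx : a ≤ x) (hy : a ≤ y) : |w n x - w n y| ≤ |x - y| / a := by
  wlog hxy : x ≤ y generalizing x y
  · rw [abs_sub_comm, abs_sub_comm x y]
    exact this hy hx (le_of_not_ge hxy)
  have hx0 := ha.trans_le hx
  have h1 := (hR.mul_v_le_sub n hx0 hxy).2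
  have h2 := hR.w_mono n hx0 hxy
  have h3 := hR.v_le n ha hx
  rw [abs_sub_comm, abs_of_nonneg (by linarith), abs_sub_comm, abs_of_nonneg (by linarith)]
  calc w n y - w n x ≤ (y - x) * v n x := h1
    _ ≤ (y - x) * (1 / a) := mul_le_mul_of_nonneg_left h3 (by linarith)
    _ = _ := by ring

lemma tendsto_w_moving (hR : IsRescaledSeq p s₀ M w v G Q) {l : Filter ℕ} {s A : ℝ} (hs : 0 < s)
    (hA : Tendsto (fun n => w n s) l (𝓝 A)) {σ : ℕ → ℝ} (hσ : Tendsto σ l (𝓝 s)) :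
    Tendsto (fun n => w n (σ n)) l (𝓝 A) := by
  have h1 : Tendsto (fun n => |σ n - s| / (s / 2)) l (𝓝 0) := by
    have : Tendsto (fun n => |σ n - s| / (s / 2)) l (𝓝 (|s - s| / (s / 2))) :=
      ((hσ.sub_const s).abs).div_const _
    simpa using this
  have h2 : Tendsto (fun n => w n (σ n) - w n s) l (𝓝 0) := by
    refine squeeze_zero_norm' ?_ h1
    filter_upwards [hσ.eventually (lt_mem_nhds (half_lt_self hs))] with n hn
    exact hR.abs_w_sub_le n (half_pos hs) hn.le (by linarith)
  simpa using h2.add hA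

lemma exists_log_G_sub_le (hR : IsRescaledSeq p s₀ M w v G Q) {ε η a : ℝ} (hε : 0 < ε)
    (hη : 0 < η) (ha : 0 < a) :
    ∀ᶠ n in atTop, ∀ x y, a ≤ x → a ≤ y → η ≤ w n x → η ≤ w n y →
      |(Real.log (G n x) / M n + 2 * x - w n x ^ p) -
        (Real.log (G n y) / M n + 2 * y - w n y ^ p)| ≤ ε / a * |x - y| := by
  filter_upwards [hR.hasDerivAt_G η hη, hR.abs_Q_sub_le ε hε η hη,
    hR.tendsto_M.eventually_gt_atTop 0] with n hG hQ hM x y hx hy hwx hwy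
  have key := Convex.norm_image_sub_le_of_norm_hasDerivWithin_le
    (f := fun s => Real.log (G n s) / M n + 2 * s - w n s ^ p)
    (f' := fun s => (Q n s - p * w n s ^ (p - 1)) * v n s)
    (s := {s | a ≤ s ∧ η ≤ w n s}) (x := y) (y := x) (C := ε / a)
    ?_ ?_ ?_ ⟨hy, hwy⟩ ⟨hx, hwx⟩
  · simpa using key
  · rintro s ⟨has, hws⟩
    have hs : 0 < s := ha.trans_le has
    obtain ⟨hG0, hG1⟩ := hG s hs hws
    have h1 := (((hG1.log hG0.ne').div_const (M n)).add ((hasDerivAt_id s).const_mul 2)).sub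
      ((hR.hasDerivAt_w n s hs).rpow_const (p := p) (Or.inl (hR.w_pos n s hs).ne'))
    refine (h1.congr_deriv ?_).hasDerivWithinAt
    field_simp
    ring
  · rintro s ⟨has, hws⟩
    have hs : 0 < s := ha.trans_le has
    rw [norm_mul, Real.norm_eq_abs, Real.norm_eq_abs, abs_of_nonneg (hR.v_nonneg n s hs)]
    calc _ ≤ ε * (1 / a) := mul_le_mul (hQ s hs hws) (hR.v_le n ha has) (hR.v_nonneg n s hs) hε.le
      _ = _ := by ring
  · refine OrdConnected.convex ⟨?_⟩
    rintro x ⟨hx, hwx⟩ y ⟨hy, hwy⟩ z hz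
    exact ⟨hx.trans hz.1, hwx.trans (hR.w_mono n (ha.trans_le hx) hz.1)⟩

end IsRescaledSeq

/-- The limit of a rescaled sequence of solutions: a concave profile `W` with slope `D`. -/
structure IsLimitProfile (p s₀ : ℝ) (W D : ℝ → ℝ) : Prop where
  s₀_pos : 0 < s₀
  pos : ∀ s, 0 < s → 0 < W s
  le_one : ∀ s, 0 < s → W s ≤ 1
  mono : ∀ a b, 0 < a → a ≤ b → W a ≤ W b
  D_anti : ∀ a b, 0 < a → a ≤ b → D b ≤ D a
  D_nonneg : ∀ s, 0 < s → 0 ≤ D s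
  mul_D_le_sub : ∀ a b, 0 < a → a ≤ b →
    (b - a) * D b ≤ W b - W a ∧ W b - W a ≤ (b - a) * D a
  mul_D_le : ∀ s, 0 < s → s * D s ≤ W s
  W_s₀ : W s₀ = 1
  rpow_le : ∀ s, 0 < s → W s ^ p ≤ 2 * s - 2 * s₀ + 1
  rigid : ∀ a b, 0 < a → a < b → (∀ s ∈ Icc a b, W s ^ p < 2 * s - 2 * s₀ + 1) → D a = D b
  jump : ∀ s, 0 < s → ∀ m₁ m₂, Tendsto D (𝓝[<] s) (𝓝 m₁) → Tendsto D (𝓝[>] s) (𝓝 m₂) →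
    m₁ = m₂ ∨ (m₁ + m₂) * (p * W s ^ (p - 1)) = 4

/-- Pointwise limits `W`, `D` of `w`, `v` along a filter. -/
structure IsLimitAlong (F : Filter ℕ) (w v : ℕ → ℝ → ℝ) (W D : ℝ → ℝ) : Prop where
  w : ∀ s, 0 < s → Tendsto (fun n => w n s) F (𝓝 (W s))
  v : ∀ s, 0 < s → Tendsto (fun n => v n s) F (𝓝 (D s))
  W_pos : ∀ s, 0 < s → 0 < W s

namespace IsRescaledSeq

variable {p s₀ : ℝ} {M : ℕ → ℝ} {w v G Q : ℕ → ℝ → ℝ}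

lemma exists_isLimitAlong (hR : IsRescaledSeq p s₀ M w v G Q) (F : Ultrafilter ℕ)
    (hF : (F : Filter ℕ) ≤ atTop) :
    ∃ W D, IsLimitAlong F w v W D ∧ W s₀ = 1 := by
  have h1 : ∀ s, ∃ y, 0 < s → Tendsto (fun n => w n s) F (𝓝 y) := by
    intro s
    by_cases hs : 0 < s
    · obtain ⟨y, -, hy⟩ := F.exists_tendsto_of_mem_Icc (x := fun n => w n s) (a := 0) (b := 1)
        (Eventually.of_forall fun n => ⟨(hR.w_pos n s hs).le, hR.w_le_one n s hs⟩)
      exact ⟨y, fun _ => hy⟩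
    · exact ⟨0, fun h => absurd h hs⟩
  have h2 : ∀ s, ∃ y, 0 < s → Tendsto (fun n => v n s) F (𝓝 y) := by
    intro s
    by_cases hs : 0 < s
    · obtain ⟨y, -, hy⟩ := F.exists_tendsto_of_mem_Icc (x := fun n => v n s) (a := 0) (b := 1 / s)
        (Eventually.of_forall fun n => ⟨hR.v_nonneg n s hs, hR.v_le n hs le_rfl⟩)
      exact ⟨y, fun _ => hy⟩
    · exact ⟨0, fun h => absurd h hs⟩
  choose W hW using h1
  choose D hD using h2
  have hs₀ := hR.s₀_pos
  have hW₀ : W s₀ = 1 := by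
    obtain ⟨σ, hσ, hw, -⟩ := hR.exists_center
    exact tendsto_nhds_unique (hR.tendsto_w_moving hs₀ (hW s₀ hs₀) (hσ.mono_left hF))
      (hw.mono_left hF)
  refine ⟨W, D, ⟨hW, hD, fun s hs => ?_⟩, hW₀⟩
  rcases le_total s s₀ with h | h
  · have key : ∀ n, w n s₀ ≤ (s₀ / s) * w n s := by
      intro n
      have h3 := (hR.mul_v_le_sub n hs h).2
      have h4 := hR.mul_v_le n s hs
      rw [div_mul_eq_mul_div, le_div_iff₀ hs]
      nlinarith [mul_le_mul_of_nonneg_left h4 (sub_nonneg.2 h)]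
    have h5 := le_of_tendsto_of_tendsto' (hW s₀ hs₀) ((hW s hs).const_mul (s₀ / s)) key
    rw [hW₀] at h5
    by_contra hneg
    have : s₀ / s * W s ≤ 0 := mul_nonpos_of_nonneg_of_nonpos (by positivity) (not_lt.1 hneg)
    linarith
  · have := le_of_tendsto_of_tendsto' (hW s₀ hs₀) (hW s hs) (fun n => hR.w_mono n hs₀ h)
    linarith

variable {F : Ultrafilter ℕ} {W D : ℝ → ℝ}

lemma tendsto_log_G (hR : IsRescaledSeq p s₀ M w v G Q) (hF : (F : Filter ℕ) ≤ atTop)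
    (hL : IsLimitAlong F w v W D) {s : ℝ} (hs : 0 < s) {τ : ℕ → ℝ}
    (hτ : Tendsto τ F (𝓝 s)) :
    Tendsto (fun n => Real.log (G n (τ n)) / M n) F (𝓝 (W s ^ p - 2 * s + 2 * s₀ - 1)) := by
  obtain ⟨σ, hσ, hw, hG⟩ := hR.exists_center
  replace hσ := hσ.mono_left hF
  replace hw := hw.mono_left hF
  replace hG := hG.mono_left hF
  have hs₀ := hR.s₀_pos
  have hwτ := hR.tendsto_w_moving hs (hL.w s hs) hτ
  have hWs := hL.W_pos s hs
  obtain ⟨a, ha, has, has₀⟩ : ∃ a, 0 < a ∧ a < s ∧ a < s₀ :=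
    ⟨min s s₀ / 2, by positivity, by linarith [min_le_left s s₀, lt_min hs hs₀],
      by linarith [min_le_right s s₀, lt_min hs hs₀]⟩
  obtain ⟨η, hη, hηs, hη1⟩ : ∃ η, 0 < η ∧ η < W s ∧ η < 1 :=
    ⟨min (W s) 1 / 2, by positivity, by linarith [min_le_left (W s) 1, lt_min hWs one_pos],
      by linarith [min_le_right (W s) 1, lt_min hWs one_pos]⟩
  have hdiff : Tendsto (fun n => (Real.log (G n (τ n)) / M n + 2 * τ n - w n (τ n) ^ p) -
      (Real.log (G n (σ n)) / M n + 2 * σ n - w n (σ n) ^ p)) F (𝓝 0) := by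
    rw [Metric.tendsto_nhds]
    intro ε hε
    have hC : Tendsto (fun n => ε * |τ n - σ n| / (|s - s₀| + 1)) F
        (𝓝 (ε * |s - s₀| / (|s - s₀| + 1))) :=
      (((hτ.sub hσ).abs).const_mul ε).div_const _
    have hlt : ε * |s - s₀| / (|s - s₀| + 1) < ε := by
      rw [div_lt_iff₀ (by positivity)]
      nlinarith
    filter_upwards [hF (hR.exists_log_G_sub_le (ε := ε * a / (|s - s₀| + 1)) (by positivity) hη ha),
      hτ.eventually (lt_mem_nhds has), hσ.eventually (lt_mem_nhds has₀),
      hwτ.eventually (lt_mem_nhds hηs), hw.eventually (lt_mem_nhds hη1),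
      hC.eventually (gt_mem_nhds hlt)] with n h1 h2 h3 h4 h5 h6
    rw [Real.dist_eq, sub_zero]
    refine (h1 _ _ h2.le h3.le h4.le h5.le).trans_lt (lt_of_eq_of_lt ?_ h6)
    field_simp
  have h1 : Tendsto (fun n => w n (τ n) ^ p) F (𝓝 (W s ^ p)) :=
    hwτ.rpow_const (Or.inl hWs.ne')
  have h2 : Tendsto (fun n => w n (σ n) ^ p) F (𝓝 (1 ^ p)) :=
    hw.rpow_const (Or.inl one_ne_zero)
  have h3 := ((((hdiff.add hG).add (hσ.const_mul 2)).sub h2).sub (hτ.const_mul 2)).add h1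
  rw [Real.one_rpow] at h2 h3
  convert h3 using 2
  · ring
  · ring

/-- Wherever the limit profile lies above the barrier, the curvature would be infinite. -/
lemma limit_rpow_le (hR : IsRescaledSeq p s₀ M w v G Q) (hp : 0 < p)
    (hF : (F : Filter ℕ) ≤ atTop)
    (hL : IsLimitAlong F w v W D) {s : ℝ} (hs : 0 < s) :
    W s ^ p ≤ 2 * s - 2 * s₀ + 1 := by
  by_contra! hcon
  set b := s + (W s ^ p - (2 * s - 2 * s₀ + 1)) / 4 with hb
  have hsb : s < b := by linarith
  choose ξ hξ hξe using fun n => exists_sub_eq_mul_of_pos hs hsb (hR.hasDerivAt_v n)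
  obtain ⟨x, hx, hξx⟩ := F.exists_tendsto_of_mem_Icc (x := ξ) (a := s) (b := b)
    (Eventually.of_forall fun n => ⟨(hξ n).1.le, (hξ n).2.le⟩)
  have hx0 : 0 < x := hs.trans_le hx.1
  have hlog := hR.tendsto_log_G hF hL hx0 hξx
  have hMF := hR.tendsto_M.mono_left hF
  have hWx : W s ^ p ≤ W x ^ p := by
    refine Real.rpow_le_rpow (hL.W_pos s hs).le ?_ hp.le
    exact le_of_tendsto_of_tendsto' (hL.w s hs) (hL.w x hx0) (fun n => hR.w_mono n hs hx.1)
  have hC : Tendsto (fun n => Real.log (1 / s / (b - s)) / M n) F (𝓝 0) :=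
    hMF.const_div_atTop _
  have hle : W x ^ p - 2 * x + 2 * s₀ - 1 ≤ 0 := by
    refine le_of_tendsto_of_tendsto hlog hC ?_
    filter_upwards [hMF.eventually_gt_atTop 0,
      hF (hR.hasDerivAt_G (W s / 2) (half_pos (hL.W_pos s hs))),
      (hL.w s hs).eventually (lt_mem_nhds (half_lt_self (hL.W_pos s hs)))] with n hM hG hwn
    have hξ0 := hs.trans (hξ n).1
    refine div_le_div_of_nonneg_right (Real.log_le_log
      (hG _ hξ0 (hwn.le.trans (hR.w_mono n hs (hξ n).1.le))).1 ?_) hM.le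
    rw [le_div_iff₀ (sub_pos.2 hsb)]
    have h1 := hξe n
    have h2 := hR.v_le n hs le_rfl
    have h3 := hR.v_nonneg n b (hs.trans hsb)
    nlinarith
  have := hx.2
  linarith

lemma limit_rigid (hR : IsRescaledSeq p s₀ M w v G Q) (hF : (F : Filter ℕ) ≤ atTop)
    (hL : IsLimitAlong F w v W D) {a b : ℝ} (ha : 0 < a) (hab : a < b)
    (hE : ∀ s ∈ Icc a b, W s ^ p < 2 * s - 2 * s₀ + 1) : D a = D b := by
  choose ξ hξ hξe using fun n => exists_sub_eq_mul_of_pos ha hab (hR.hasDerivAt_v n)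
  obtain ⟨x, hx, hξx⟩ := F.exists_tendsto_of_mem_Icc (x := ξ) (a := a) (b := b)
    (Eventually.of_forall fun n => ⟨(hξ n).1.le, (hξ n).2.le⟩)
  have hx0 : 0 < x := ha.trans_le hx.1
  have hlog := hR.tendsto_log_G hF hL hx0 hξx
  have hMF := hR.tendsto_M.mono_left hF
  have h1 : Tendsto (fun n => Real.log (G n (ξ n))) F atBot := by
    have h2 : Tendsto (fun n => Real.log (G n (ξ n)) / M n * M n) F atBot :=
      Tendsto.neg_mul_atTop (by linarith [hE x hx]) hlog hMF
    refine h2.congr' ?_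
    filter_upwards [hMF.eventually_gt_atTop 0] with n hM
    field_simp
  have h3 : Tendsto (fun n => G n (ξ n)) F (𝓝 0) := by
    refine (Real.tendsto_exp_atBot.comp h1).congr' ?_
    filter_upwards [hF (hR.hasDerivAt_G (W a / 2) (half_pos (hL.W_pos a ha))),
      (hL.w a ha).eventually (lt_mem_nhds (half_lt_self (hL.W_pos a ha)))] with n hG hwn
    exact Real.exp_log (hG _ (ha.trans (hξ n).1) (hwn.le.trans (hR.w_mono n ha (hξ n).1.le))).1
  have h4 : Tendsto (fun n => v n b - v n a) F (𝓝 ((b - a) * -0)) := by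
    refine (h3.neg.const_mul (b - a)).congr fun n => (hξe n).symm
  have h5 := tendsto_nhds_unique h4 ((hL.v b (ha.trans hab)).sub (hL.v a ha))
  simp only [neg_zero, mul_zero] at h5
  linarith

end IsRescaledSeq
end

section
open Set Topology
namespace IsRescaledSeq

variable {p s₀ : ℝ} {M : ℕ → ℝ} {w v G Q : ℕ → ℝ → ℝ} {F : Ultrafilter ℕ} {W D : ℝ → ℝ}

/-- In every interval the energy density `G n / M n` is somewhere negligible. -/
lemma exists_G_div_tendsto (hR : IsRescaledSeq p s₀ M w v G Q) (hF : (F : Filter ℕ) ≤ atTop)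
    (hL : IsLimitAlong F w v W D) {a b : ℝ} (ha : 0 < a) (hab : a < b) :
    ∃ ξ : ℕ → ℝ, (∀ n, ξ n ∈ Ioo a b) ∧ Tendsto (fun n => G n (ξ n) / M n) F (𝓝 0) ∧
      ∃ x ∈ Icc (D b) (D a), Tendsto (fun n => v n (ξ n)) F (𝓝 x) := by
  choose ξ hξ hξe using fun n => exists_sub_eq_mul_of_pos ha hab (hR.hasDerivAt_v n)
  have hMF := hR.tendsto_M.mono_left hF
  refine ⟨ξ, hξ, ?_, ?_⟩
  · have hC : Tendsto (fun n => 1 / a / (b - a) / M n) F (𝓝 0) := hMF.const_div_atTop _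
    refine squeeze_zero' ?_ ?_ hC
    · filter_upwards [hMF.eventually_gt_atTop 0] with n hM
      exact div_nonneg (hR.G_nonneg n _ (ha.trans (hξ n).1)) hM.le
    · filter_upwards [hMF.eventually_gt_atTop 0] with n hM
      refine div_le_div_of_nonneg_right ?_ hM.le
      rw [le_div_iff₀ (sub_pos.2 hab)]
      have h1 := hξe n
      have h2 := hR.v_le n ha le_rfl
      have h3 := hR.v_nonneg n b (ha.trans hab)
      nlinarith
  · obtain ⟨x, -, hx⟩ := F.exists_tendsto_of_mem_Icc (x := fun n => v n (ξ n)) (a := 0)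
      (b := 1 / a) (Eventually.of_forall fun n =>
        ⟨hR.v_nonneg n _ (ha.trans (hξ n).1), hR.v_le n ha (hξ n).1.le⟩)
    refine ⟨x, ⟨?_, ?_⟩, hx⟩
    · exact le_of_tendsto_of_tendsto' (hL.v b (ha.trans hab)) hx
        (fun n => hR.v_anti n (ha.trans (hξ n).1) (hξ n).2.le)
    · exact le_of_tendsto_of_tendsto' hx (hL.v a ha)
        (fun n => hR.v_anti n ha (hξ n).1.le)

/-- Approximate conservation of energy across the point `s`. -/
lemma exists_energy_sub_le (hR : IsRescaledSeq p s₀ M w v G Q) (hF : (F : Filter ℕ) ≤ atTop)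
    (hL : IsLimitAlong F w v W D) (q : ℝ) {s ρ : ℝ} (hs : 0 < s) (hρ : 0 < ρ)
    (hρs : 4 * ρ < s) :
    ∃ x ∈ Icc (D (s - ρ)) (D (s - 2 * ρ)), ∃ y ∈ Icc (D (s + 2 * ρ)) (D (s + ρ)),
      ∃ θ ∈ Icc (s - 2 * ρ) (s + 2 * ρ), ∃ z, |z| ≤ 2 / s ∧
        (q * y ^ 2 / 2 - 2 * y) - (q * x ^ 2 / 2 - 2 * x) =
          (x - y) * z * (p * W θ ^ (p - 1) - q) := by
  have hMF := hR.tendsto_M.mono_left hF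
  obtain ⟨ξ, hξ, hξG, x, hx, hξx⟩ := hR.exists_G_div_tendsto hF hL
    (a := s - 2 * ρ) (b := s - ρ) (by linarith) (by linarith)
  obtain ⟨ζ, hζ, hζG, y, hy, hζy⟩ := hR.exists_G_div_tendsto hF hL
    (a := s + ρ) (b := s + 2 * ρ) (by linarith) (by linarith)
  have hs2 : s / 2 < s - 2 * ρ := by linarith
  set η := W (s - 2 * ρ) / 2 with hη
  have hWpos := hL.W_pos (s - 2 * ρ) (by linarith)
  have hη0 : 0 < η := half_pos hWpos
  have hwη : ∀ᶠ n in (F : Filter ℕ), ∀ t, s - 2 * ρ ≤ t → η ≤ w n t := by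
    filter_upwards [(hL.w (s - 2 * ρ) (by linarith)).eventually
      (lt_mem_nhds (half_lt_self hWpos))] with n hn t ht
    exact hn.le.trans (hR.w_mono n (by linarith) ht)
  have hstep : ∀ᶠ n in (F : Filter ℕ), ∃ θ ∈ Ioo (ξ n) (ζ n),
      (G n (ζ n) / M n - 2 * v n (ζ n) + q * v n (ζ n) ^ 2 / 2) -
        (G n (ξ n) / M n - 2 * v n (ξ n) + q * v n (ξ n) ^ 2 / 2) =
      (v n (ξ n) - v n (ζ n)) * v n θ * (Q n θ - q) := by
    filter_upwards [hwη, hF (hR.hasDerivAt_G η hη0), hMF.eventually_gt_atTop 0] with n h1 h2 hM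
    have hlt : ξ n < ζ n := by linarith [(hξ n).2, (hζ n).1]
    have hpos : ∀ t ∈ Icc (ξ n) (ζ n), 0 < t := fun t ht => by linarith [(hξ n).1, ht.1]
    have hder : ∀ t ∈ Icc (ξ n) (ζ n),
        HasDerivAt (fun t => G n t / M n - 2 * v n t + q * v n t ^ 2 / 2)
          (G n t * v n t * (Q n t - q)) t := by
      intro t ht
      obtain ⟨-, hG⟩ := h2 t (hpos t ht) (h1 t (by linarith [(hξ n).1, ht.1]))
      have hv := hR.hasDerivAt_v n t (hpos t ht)
      refine (((hG.div_const (M n)).sub (hv.const_mul 2)).add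
        (((hv.pow 2).const_mul q).div_const 2)).congr_deriv ?_
      field_simp
      norm_num
      ring
    obtain ⟨θ, hθ, h⟩ := exists_ratio_hasDerivAt_eq_ratio_slope _ _ hlt
      (fun t ht => (hder t ht).continuousAt.continuousWithinAt)
      (fun t ht => hder t (Ioo_subset_Icc_self ht)) (v n) (fun t => -(G n t))
      (fun t ht => (hR.hasDerivAt_v n t (hpos t ht)).continuousAt.continuousWithinAt)
      (fun t ht => hR.hasDerivAt_v n t (hpos t (Ioo_subset_Icc_self ht)))
    refine ⟨θ, hθ, ?_⟩
    have hθ' := Ioo_subset_Icc_self hθ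
    obtain ⟨hG, -⟩ := h2 θ (hpos θ hθ') (h1 θ (by linarith [(hξ n).1, hθ.1]))
    refine mul_right_cancel₀ hG.ne' ?_
    linear_combination h
  have hchoice : ∀ n, ∃ t, (∃ θ ∈ Ioo (ξ n) (ζ n),
      (G n (ζ n) / M n - 2 * v n (ζ n) + q * v n (ζ n) ^ 2 / 2) -
        (G n (ξ n) / M n - 2 * v n (ξ n) + q * v n (ξ n) ^ 2 / 2) =
      (v n (ξ n) - v n (ζ n)) * v n θ * (Q n θ - q)) → t ∈ Ioo (ξ n) (ζ n) ∧
      (G n (ζ n) / M n - 2 * v n (ζ n) + q * v n (ζ n) ^ 2 / 2) -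
        (G n (ξ n) / M n - 2 * v n (ξ n) + q * v n (ξ n) ^ 2 / 2) =
      (v n (ξ n) - v n (ζ n)) * v n t * (Q n t - q) := by
    intro n
    by_cases h : ∃ θ ∈ Ioo (ξ n) (ζ n),
      (G n (ζ n) / M n - 2 * v n (ζ n) + q * v n (ζ n) ^ 2 / 2) -
        (G n (ξ n) / M n - 2 * v n (ξ n) + q * v n (ξ n) ^ 2 / 2) =
      (v n (ξ n) - v n (ζ n)) * v n θ * (Q n θ - q)
    · obtain ⟨θ, h1, h2⟩ := h
      exact ⟨θ, fun _ => ⟨h1, h2⟩⟩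
    · exact ⟨0, fun h' => absurd h' h⟩
  choose θ hθ using hchoice
  replace hθ := hstep.mono fun n => hθ n
  have hθIcc : ∀ᶠ n in (F : Filter ℕ), θ n ∈ Icc (s - 2 * ρ) (s + 2 * ρ) := by
    filter_upwards [hθ] with n hn
    exact ⟨((hξ n).1.trans hn.1.1).le, (hn.1.2.trans (hζ n).2).le⟩
  obtain ⟨t, ht, hθt⟩ := F.exists_tendsto_of_mem_Icc hθIcc
  have ht0 : 0 < t := by linarith [ht.1]
  have hvθ : ∀ᶠ n in (F : Filter ℕ), v n (θ n) ∈ Icc 0 (2 / s) := by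
    filter_upwards [hθIcc] with n hn
    refine ⟨hR.v_nonneg n _ (by linarith [hn.1]), ?_⟩
    have := hR.v_le n (half_pos hs) (s := θ n) (by linarith [hn.1])
    rwa [one_div_div] at this
  obtain ⟨z, hz, hvz⟩ := F.exists_tendsto_of_mem_Icc hvθ
  have hwθ := hR.tendsto_w_moving ht0 (hL.w t ht0) hθt
  have hQ : Tendsto (fun n => Q n (θ n)) F (𝓝 (p * W t ^ (p - 1))) := by
    have h1 : Tendsto (fun n => p * w n (θ n) ^ (p - 1)) F (𝓝 (p * W t ^ (p - 1))) :=
      (hwθ.rpow_const (Or.inl (hL.W_pos t ht0).ne')).const_mul p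
    have h2 : Tendsto (fun n => Q n (θ n) - p * w n (θ n) ^ (p - 1)) F (𝓝 0) := by
      rw [Metric.tendsto_nhds]
      intro ε hε
      filter_upwards [hF (hR.abs_Q_sub_le (ε / 2) (half_pos hε) η hη0), hwη, hθIcc]
        with n h1 h2 h3
      rw [Real.dist_eq, sub_zero]
      exact (h1 _ (by linarith [h3.1]) (h2 _ h3.1)).trans_lt (half_lt_self hε)
    simpa using h2.add h1
  refine ⟨x, hx, y, hy, t, ht, z, abs_le.2 ⟨by linarith [hz.1, div_pos two_pos hs], hz.2⟩, ?_⟩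
  have hlhs := ((hζG.sub (hζy.const_mul 2)).add (((hζy.pow 2).const_mul q).div_const 2)).sub
    ((hξG.sub (hξx.const_mul 2)).add (((hξx.pow 2).const_mul q).div_const 2))
  have hrhs := ((hξx.sub hζy).mul hvz).mul (hQ.sub_const q)
  have := tendsto_nhds_unique (hlhs.congr' (hθ.mono fun n hn => hn.2)) hrhs
  linear_combination this

lemma limit_jump (hR : IsRescaledSeq p s₀ M w v G Q) (hF : (F : Filter ℕ) ≤ atTop)
    (hL : IsLimitAlong F w v W D) {s m₁ m₂ : ℝ} (hs : 0 < s)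
    (h₁ : Tendsto D (𝓝[<] s) (𝓝 m₁)) (h₂ : Tendsto D (𝓝[>] s) (𝓝 m₂)) :
    m₁ = m₂ ∨ (m₁ + m₂) * (p * W s ^ (p - 1)) = 4 := by
  set q := p * W s ^ (p - 1) with hq
  have hρ0 : Tendsto (fun k : ℕ => s / (4 * ((k : ℝ) + 2))) atTop (𝓝 0) :=
    (tendsto_const_nhds).div_atTop
      ((tendsto_natCast_atTop_atTop.atTop_add tendsto_const_nhds).const_mul_atTop four_pos)
  set ρ : ℕ → ℝ := fun k => s / (4 * ((k : ℝ) + 2)) with hρ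
  have hρpos : ∀ k, 0 < ρ k := fun k => by positivity
  have hρs : ∀ k, 4 * ρ k < s := by
    intro k
    rw [hρ]
    field_simp
    have : (0 : ℝ) ≤ k := Nat.cast_nonneg k
    linarith
  choose x hx y hy θ hθ z hz he using
    fun k => hR.exists_energy_sub_le hF hL q hs (hρpos k) (hρs k)
  have hleft : ∀ c : ℝ, 0 < c → Tendsto (fun k => D (s - c * ρ k)) atTop (𝓝 m₁) := by
    intro c hc
    refine h₁.comp (tendsto_nhdsWithin_iff.2 ⟨?_, Eventually.of_forall fun k => ?_⟩)
    · simpa using (hρ0.const_mul c).const_sub s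
    · have := mul_pos hc (hρpos k)
      simp only [mem_Iio]; linarith
  have hright : ∀ c : ℝ, 0 < c → Tendsto (fun k => D (s + c * ρ k)) atTop (𝓝 m₂) := by
    intro c hc
    refine h₂.comp (tendsto_nhdsWithin_iff.2 ⟨?_, Eventually.of_forall fun k => ?_⟩)
    · simpa using (hρ0.const_mul c).const_add s
    · have := mul_pos hc (hρpos k)
      simp only [mem_Ioi]; linarith
  have hx' : Tendsto x atTop (𝓝 m₁) :=
    tendsto_of_tendsto_of_tendsto_of_le_of_le (by simpa using hleft 1 one_pos) (hleft 2 two_pos)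
      (fun k => (hx k).1) (fun k => (hx k).2)
  have hy' : Tendsto y atTop (𝓝 m₂) :=
    tendsto_of_tendsto_of_tendsto_of_le_of_le (hright 2 two_pos) (by simpa using hright 1 one_pos)
      (fun k => (hy k).1) (fun k => (hy k).2)
  have hW' : Tendsto (fun k => W (θ k)) atTop (𝓝 (W s)) := by
    have hbd : ∀ k, |W (θ k) - W s| ≤ 4 / s * ρ k := by
      intro k
      have hθ0 : s / 2 ≤ θ k := by linarith [(hθ k).1, hρs k]
      refine le_of_tendsto (((hL.w (θ k) (by linarith)).sub (hL.w s hs)).abs)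
        (Eventually.of_forall fun n => ?_)
      refine (hR.abs_w_sub_le n (half_pos hs) hθ0 (by linarith)).trans ?_
      have : |θ k - s| ≤ 2 * ρ k := abs_le.2 ⟨by linarith [(hθ k).1], by linarith [(hθ k).2]⟩
      calc |θ k - s| / (s / 2) ≤ 2 * ρ k / (s / 2) := by gcongr
        _ = _ := by field_simp; norm_num; ring
    have h0 : Tendsto (fun k => 4 / s * ρ k) atTop (𝓝 0) := by simpa using hρ0.const_mul (4 / s)
    have := squeeze_zero_norm (f := fun k => W (θ k) - W s) hbd h0
    simpa using this.add_const (W s)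
  have hq' : Tendsto (fun k => p * W (θ k) ^ (p - 1) - q) atTop (𝓝 0) := by
    have := ((hW'.rpow_const (p := p - 1) (Or.inl (hL.W_pos s hs).ne')).const_mul p).sub_const q
    simpa [hq] using this
  have hrhs : Tendsto (fun k => (x k - y k) * z k * (p * W (θ k) ^ (p - 1) - q)) atTop (𝓝 0) := by
    have h1 : Tendsto (fun k => (x k - y k) * (p * W (θ k) ^ (p - 1) - q) * z k) atTop (𝓝 0) := by
      refine Tendsto.zero_mul_isBoundedUnder_le ?_ ?_
      · simpa using (hx'.sub hy').mul hq'
      · exact isBoundedUnder_of ⟨2 / s, hz⟩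
    refine h1.congr fun k => by ring
  have hlhs := ((((hy'.pow 2).const_mul q).div_const 2).sub (hy'.const_mul 2)).sub
    ((((hx'.pow 2).const_mul q).div_const 2).sub (hx'.const_mul 2))
  have key := tendsto_nhds_unique (hlhs.congr he) hrhs
  have : (m₁ - m₂) * ((m₁ + m₂) * q - 4) = 0 := by linear_combination -2 * key
  rcases mul_eq_zero.1 this with h | h
  · exact Or.inl (sub_eq_zero.1 h)
  · exact Or.inr (sub_eq_zero.1 h)

theorem exists_isLimitProfile (hR : IsRescaledSeq p s₀ M w v G Q) (hp : 0 < p)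
    (F : Ultrafilter ℕ) (hF : (F : Filter ℕ) ≤ atTop) :
    ∃ W D, IsLimitProfile p s₀ W D ∧ ∀ s, 0 < s → Tendsto (fun n => w n s) F (𝓝 (W s)) := by
  obtain ⟨W, D, hL, hW₀⟩ := hR.exists_isLimitAlong F hF
  refine ⟨W, D, ⟨hR.s₀_pos, hL.W_pos, ?_, ?_, ?_, ?_, ?_, ?_, hW₀,
    fun s hs => hR.limit_rpow_le hp hF hL hs,
    fun a b ha hab hE => hR.limit_rigid hF hL ha hab hE,
    fun s hs m₁ m₂ h₁ h₂ => hR.limit_jump hF hL hs h₁ h₂⟩, hL.w⟩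
  · exact fun s hs => le_of_tendsto' (hL.w s hs) fun n => hR.w_le_one n s hs
  · exact fun a b ha hab => le_of_tendsto_of_tendsto' (hL.w a ha) (hL.w b (ha.trans_le hab))
      fun n => hR.w_mono n ha hab
  · exact fun a b ha hab => le_of_tendsto_of_tendsto' (hL.v b (ha.trans_le hab)) (hL.v a ha)
      fun n => hR.v_anti n ha hab
  · exact fun s hs => ge_of_tendsto' (hL.v s hs) fun n => hR.v_nonneg n s hs
  · intro a b ha hab
    have hb := ha.trans_le hab
    exact ⟨le_of_tendsto_of_tendsto' ((hL.v b hb).const_mul _) ((hL.w b hb).sub (hL.w a ha))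
        fun n => (hR.mul_v_le_sub n ha hab).1,
      le_of_tendsto_of_tendsto' ((hL.w b hb).sub (hL.w a ha)) ((hL.v a ha).const_mul _)
        fun n => (hR.mul_v_le_sub n ha hab).2⟩
  · exact fun s hs => le_of_tendsto_of_tendsto' ((hL.v s hs).const_mul s) (hL.w s hs)
      fun n => hR.mul_v_le n s hs

end IsRescaledSeq
end

section
open Set Topology
namespace IsLimitProfile

variable {p s₀ : ℝ} {W D : ℝ → ℝ}

lemma continuousAt_W (h : IsLimitProfile p s₀ W D) {s : ℝ} (hs : 0 < s) : ContinuousAt W s := by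
  have h0 : Tendsto (fun x => |x - s| * D (s / 2)) (𝓝 s) (𝓝 0) := by
    have : Tendsto (fun x => |x - s| * D (s / 2)) (𝓝 s) (𝓝 (|s - s| * D (s / 2))) :=
      (((continuous_id.sub continuous_const).abs).mul continuous_const).tendsto s
    simpa using this
  have h1 : Tendsto (fun x => W x - W s) (𝓝 s) (𝓝 0) := by
    refine squeeze_zero_norm' ?_ h0
    filter_upwards [lt_mem_nhds (half_lt_self hs)] with x hx
    have hD := fun y hy => h.D_anti (s / 2) y (half_pos hs) hy
    have hx0 : 0 < x := (half_pos hs).trans hx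
    rw [Real.norm_eq_abs]
    rcases le_total x s with hxs | hxs
    · have h2 := (h.mul_D_le_sub x s hx0 hxs).2
      have h3 := h.mono x s hx0 hxs
      rw [abs_sub_comm, abs_of_nonneg (by linarith), abs_sub_comm, abs_of_nonneg (by linarith)]
      exact h2.trans (mul_le_mul_of_nonneg_left (hD x hx.le) (by linarith))
    · have h2 := (h.mul_D_le_sub s x hs hxs).2
      have h3 := h.mono s x hs hxs
      rw [abs_of_nonneg (by linarith), abs_of_nonneg (by linarith)]
      exact h2.trans (mul_le_mul_of_nonneg_left (hD s (by linarith)) (by linarith))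
  have h2 := h1.add_const (W s)
  simp only [sub_add_cancel, zero_add] at h2
  exact h2

lemma tendsto_D_right_s₀ (h : IsLimitProfile p s₀ W D) : Tendsto D (𝓝[>] s₀) (𝓝 0) := by
  refine tendsto_const_nhds.congr' ?_
  filter_upwards [self_mem_nhdsWithin] with b hb
  have hb : s₀ < b := hb
  have h1 := (h.mul_D_le_sub s₀ b h.s₀_pos hb.le).1
  have h2 := h.le_one b (h.s₀_pos.trans hb)
  have h3 := h.D_nonneg b (h.s₀_pos.trans hb)
  rw [h.W_s₀] at h1
  have h4 : D b ≤ 0 := by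
    by_contra! h5
    have := mul_pos (sub_pos.2 hb) h5
    linarith
  exact le_antisymm h3 h4

lemma exists_tendsto_D_left (h : IsLimitProfile p s₀ W D) {s : ℝ} (hs : 0 < s) :
    ∃ m, Tendsto D (𝓝[<] s) (𝓝 m) := by
  refine ⟨_, AntitoneOn.tendsto_nhdsWithin_Ioo_left (y := 0) (nonempty_Ioo.2 hs) ?_ ?_⟩
  · exact fun a ha b _ hab => h.D_anti a b ha.1 hab
  · refine ⟨0, ?_⟩
    rintro _ ⟨x, hx, rfl⟩
    exact h.D_nonneg x hx.1

/-- To the left of a point of contact with the barrier, the profile is at least as steep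
as the barrier. -/
lemma two_le_left_slope (h : IsLimitProfile p s₀ W D) (hp : 0 < p) {s m : ℝ} (hs : 0 < s)
    (hE : W s ^ p = 2 * s - 2 * s₀ + 1) (hm : Tendsto D (𝓝[<] s) (𝓝 m)) :
    2 ≤ p * W s ^ (p - 1) * m := by
  by_contra! hlt
  have hWs := h.pos s hs
  have hq : 0 < p * W s ^ (p - 1) := by positivity
  obtain ⟨m', hmm', hm'⟩ : ∃ m', m < m' ∧ p * W s ^ (p - 1) * m' < 2 := by
    have : m < 2 / (p * W s ^ (p - 1)) := by rw [lt_div_iff₀ hq]; linarith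
    obtain ⟨m', h1, h2⟩ := exists_between this
    exact ⟨m', h1, by rw [lt_div_iff₀ hq] at h2; linarith⟩
  have hlin : HasDerivAt (fun x => W s - m' * (s - x)) m' s := by
    refine ((((hasDerivAt_id s).const_sub s).const_mul m').const_sub (W s)).congr_deriv ?_
    ring
  have hder : HasDerivAt (fun x => (W s - m' * (s - x)) ^ p - (2 * x - 2 * s₀ + 1))
      (m' * p * W s ^ (p - 1) - 2) s := by
    have h1 := hlin.rpow_const (p := p) (Or.inl (by simp [hWs.ne']))
    refine (h1.sub ((((hasDerivAt_id s).const_mul 2).sub_const (2 * s₀)).add_const 1)).congr_deriv ?_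
    simp
  have hslope := (hasDerivAt_iff_tendsto_slope.1 hder).mono_left
    (nhdsWithin_mono s (fun x (hx : x < s) => hx.ne) : 𝓝[<] s ≤ 𝓝[≠] s)
  have hneg : m' * p * W s ^ (p - 1) - 2 < 0 := by linarith
  have hbase : ∀ᶠ x in 𝓝[<] s, 0 < W s - m' * (s - x) :=
    (hlin.continuousAt.tendsto.mono_left nhdsWithin_le_nhds).eventually
      (lt_mem_nhds (by simpa using hWs))
  have hpos : ∀ᶠ x in 𝓝[<] s, 0 < x := nhdsWithin_le_nhds (lt_mem_nhds hs)
  obtain ⟨x, h1, h2, h3, h4, h5⟩ := (((hslope.eventually (gt_mem_nhds hneg)).and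
    ((hm.eventually (gt_mem_nhds hmm')).and (hbase.and
      (hpos.and self_mem_nhdsWithin))))).exists
  have h5 : x < s := h5
  rw [slope_def_field, div_neg_iff] at h1
  have h6 := h.rpow_le x h4
  have h7 := (h.mul_D_le_sub x s h4 h5.le).2
  have h8 : (W s - m' * (s - x)) ^ p ≤ W x ^ p := by
    refine Real.rpow_le_rpow h3.le ?_ hp.le
    nlinarith [mul_le_mul_of_nonneg_left h2.le (sub_nonneg.2 h5.le)]
  simp only [sub_self, mul_zero, sub_zero, hE] at h1
  rcases h1 with h1 | h1 <;> linarith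

/-- The slope of the profile is reflected at a point of contact with the barrier. -/
lemma tendsto_D_left_of_right (h : IsLimitProfile p s₀ W D) (hp : 0 < p) {s m : ℝ} (hs : 0 < s)
    (hE : W s ^ p = 2 * s - 2 * s₀ + 1) (hm : Tendsto D (𝓝[>] s) (𝓝 m))
    (hlt : p * W s ^ (p - 1) * m < 2) :
    Tendsto D (𝓝[<] s) (𝓝 (4 / (p * W s ^ (p - 1)) - m)) := by
  obtain ⟨m₁, hm₁⟩ := h.exists_tendsto_D_left hs
  have hWs := h.pos s hs
  have hq : 0 < p * W s ^ (p - 1) := by positivity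
  have h1 := h.two_le_left_slope hp hs hE hm₁
  rcases h.jump s hs m₁ m hm₁ hm with h2 | h2
  · rw [h2] at h1; linarith
  · convert hm₁ using 2
    rw [← h2]
    field_simp
    ring

lemma le_tangent (h : IsLimitProfile p s₀ W D) {a s m : ℝ} (ha : 0 < a) (has : a ≤ s)
    (hm : Tendsto D (𝓝[<] s) (𝓝 m)) : W a ≤ W s - m * (s - a) := by
  rcases has.eq_or_lt with rfl | has
  · simp
  have h1 : Tendsto (fun b => (b - a) * D b) (𝓝[<] s) (𝓝 ((s - a) * m)) :=
    (((continuous_id.sub continuous_const).tendsto s).mono_left nhdsWithin_le_nhds).mul hm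
  have h2 : (s - a) * m ≤ W s - W a := by
    refine le_of_tendsto h1 ?_
    filter_upwards [Ioo_mem_nhdsLT has] with b hb
    have h3 := (h.mul_D_le_sub a b ha hb.1.le).1
    have h4 := h.mono b s (ha.trans hb.1) hb.2.le
    linarith
  linarith

/-- As long as the tangent line stays below the barrier, the profile follows it. -/
lemma eq_tangent (h : IsLimitProfile p s₀ W D) (hp : 0 < p) {b s m : ℝ} (hb : 0 < b)
    (hbs : b < s) (hm : Tendsto D (𝓝[<] s) (𝓝 m))
    (hlt : ∀ x ∈ Ioo b s, (W s - m * (s - x)) ^ p < 2 * x - 2 * s₀ + 1) :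
    (∀ x ∈ Icc b s, W x = W s - m * (s - x)) ∧ Tendsto D (𝓝[>] b) (𝓝 m) := by
  have hE : ∀ x ∈ Ioo b s, W x ^ p < 2 * x - 2 * s₀ + 1 := by
    intro x hx
    have hx0 := hb.trans hx.1
    exact (Real.rpow_le_rpow (h.pos x hx0).le (h.le_tangent hx0 hx.2.le hm) hp.le).trans_lt
      (hlt x hx)
  have hD : ∀ x ∈ Ioo b s, D x = m := by
    intro x hx
    refine tendsto_nhds_unique (tendsto_const_nhds.congr' ?_) hm
    filter_upwards [Ioo_mem_nhdsLT hx.2] with y hy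
    exact h.rigid x y (hb.trans hx.1) hy.1
      fun z hz => hE z ⟨hx.1.trans_le hz.1, hz.2.trans_lt hy.2⟩
  have hW : ∀ x ∈ Ioo b s, W x = W s - m * (s - x) := by
    intro x hx
    have hx0 := hb.trans hx.1
    refine le_antisymm (h.le_tangent hx0 hx.2.le hm) ?_
    have := (h.mul_D_le_sub x s hx0 hx.2.le).2
    rw [hD x hx] at this
    linarith
  refine ⟨fun x hx => ?_, ?_⟩
  · rcases hx.2.eq_or_lt with rfl | hxs
    · simp
    rcases hx.1.eq_or_lt with rfl | hbx
    · have h1 : Tendsto W (𝓝[>] b) (𝓝 (W b)) :=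
        (h.continuousAt_W hb).tendsto.mono_left nhdsWithin_le_nhds
      have h2 : Tendsto (fun x => W s - m * (s - x)) (𝓝[>] b) (𝓝 (W s - m * (s - b))) := by
        have : Continuous (fun x => W s - m * (s - x)) := by fun_prop
        exact (this.tendsto b).mono_left nhdsWithin_le_nhds
      refine tendsto_nhds_unique (h1.congr' ?_) h2
      filter_upwards [Ioo_mem_nhdsGT hbs] with x hx using hW x hx
    · exact hW x ⟨hbx, hxs⟩
  · refine tendsto_const_nhds.congr' ?_
    filter_upwards [Ioo_mem_nhdsGT hbs] with x hx using (hD x hx).symm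

lemma tendsto_D_left_s₀ (h : IsLimitProfile p s₀ W D) (hp : 0 < p) :
    Tendsto D (𝓝[<] s₀) (𝓝 (4 / p)) := by
  have := h.tendsto_D_left_of_right hp h.s₀_pos (by rw [h.W_s₀]; simp) h.tendsto_D_right_s₀
    (by simp)
  simpa [h.W_s₀] using this

/-- For `s₀ = p / 4` the profile is the straight line through the origin. -/
lemma eq_line (h : IsLimitProfile p (p / 4) W D) (hp : 0 < p) {s : ℝ} (hs : 0 < s)
    (hs' : s ≤ p / 4) : W s = 4 * s / p := by
  have h1 := h.le_tangent hs hs' (h.tendsto_D_left_s₀ hp)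
  have h2 := (h.mul_D_le_sub s _ hs hs').2
  have h3 := h.mul_D_le s hs
  rw [h.W_s₀] at h1 h2
  refine le_antisymm (h1.trans (le_of_eq (by field_simp; ring))) ?_
  rw [div_le_iff₀ hp]
  nlinarith [mul_le_mul_of_nonneg_left h3 (sub_nonneg.2 hs')]

end IsLimitProfile

lemma chord_rpow_lt {p : ℝ} (hp : 1 < p) {δ δ' m : ℝ} (hδ' : 0 < δ') (hδ : δ' < δ)
    (hm : δ - m * (δ ^ p / 2 - δ' ^ p / 2) = δ') {x : ℝ}
    (hx : x ∈ Ioo (δ' ^ p / 2) (δ ^ p / 2)) :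
    (δ - m * (δ ^ p / 2 - x)) ^ p < 2 * x := by
  have hd : 0 < δ ^ p / 2 - δ' ^ p / 2 := by linarith [hx.1, hx.2]
  set t := (x - δ' ^ p / 2) / (δ ^ p / 2 - δ' ^ p / 2) with ht
  have ht0 : 0 < t := div_pos (by linarith [hx.1]) hd
  have ht1 : t < 1 := by rw [ht, div_lt_one hd]; linarith [hx.2]
  have hxt : x = (1 - t) * (δ' ^ p / 2) + t * (δ ^ p / 2) := by
    have : t * (δ ^ p / 2 - δ' ^ p / 2) = x - δ' ^ p / 2 := div_mul_cancel₀ _ hd.ne'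
    linear_combination -this
  have key := (strictConvexOn_rpow hp).2 (mem_Ici.2 hδ'.le) (mem_Ici.2 (hδ'.trans hδ).le) hδ.ne
    (sub_pos.2 ht1) ht0 (by ring)
  simp only [smul_eq_mul] at key
  have hL : δ - m * (δ ^ p / 2 - x) = (1 - t) * δ' + t * δ := by
    rw [hxt]
    linear_combination (1 - t) * hm
  rw [hL]
  linarith

namespace IsBubbleSeq

variable {p : ℝ} {a δ : ℕ → ℝ}

lemma δ_pos (h : IsBubbleSeq p a δ) (j : ℕ) : 0 < δ j := by
  cases j with
  | zero => rw [h.2.1]; exact one_pos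
  | succ j => exact (h.2.2 j).1.1

lemma a_pos (h : IsBubbleSeq p a δ) (j : ℕ) : 0 < a j := by
  cases j with
  | zero => rw [h.1]; exact two_pos
  | succ j => exact (h.2.2 j).2.2.2.1

lemma a_le_two (h : IsBubbleSeq p a δ) (j : ℕ) : a j ≤ 2 := by
  cases j with
  | zero => rw [h.1]
  | succ j => exact (h.2.2 j).2.2.2.2.le

lemma line_at_succ (h : IsBubbleSeq p a δ) (hp : 0 < p) (j : ℕ) :
    δ j - (2 + a j) / (p * δ j ^ (p - 1)) * (δ j ^ p / 2 - δ (j + 1) ^ p / 2) = δ (j + 1) := by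
  have hδ := h.δ_pos j
  have hδ' := h.δ_pos (j + 1)
  have ha := h.a_pos j
  have h1 := (h.2.2 j).2.1
  rw [Real.div_rpow hδ'.le hδ.le] at h1
  have h2 : δ j ^ p = δ j ^ (p - 1) * δ j := by
    rw [← Real.rpow_add_one hδ.ne']; simp
  have h3 : 0 < δ j ^ (p - 1) := by positivity
  rw [h2] at h1 ⊢
  field_simp at h1 ⊢
  linear_combination h1

end IsBubbleSeq

/-- For `s₀ = 1 / 2` the profile is the broken line given by the bubble sequence. -/
theorem IsLimitProfile.eq_bubble_line {p : ℝ} {W D : ℝ → ℝ} {a δ : ℕ → ℝ}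
    (h : IsLimitProfile p (1 / 2) W D) (hp : 2 < p) (hb : IsBubbleSeq p a δ) (j : ℕ) :
    ∀ x ∈ Icc (δ (j + 1) ^ p / 2) (δ j ^ p / 2),
      W x = δ j - (2 + a j) / (p * δ j ^ (p - 1)) * (δ j ^ p / 2 - x) := by
  have hp0 : 0 < p := by linarith
  have hs : ∀ i, 0 < δ i ^ p / 2 := fun i => by have := hb.δ_pos i; positivity
  have step : ∀ i, W (δ i ^ p / 2) = δ i →
      Tendsto D (𝓝[<] (δ i ^ p / 2)) (𝓝 ((2 + a i) / (p * δ i ^ (p - 1)))) →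
      (∀ x ∈ Icc (δ (i + 1) ^ p / 2) (δ i ^ p / 2),
        W x = δ i - (2 + a i) / (p * δ i ^ (p - 1)) * (δ i ^ p / 2 - x)) ∧
      Tendsto D (𝓝[>] (δ (i + 1) ^ p / 2)) (𝓝 ((2 + a i) / (p * δ i ^ (p - 1)))) := by
    intro i h1 h2
    have hlt := (hb.2.2 i).1.2
    have h3 := h.eq_tangent hp0 (hs (i + 1)) (by
      have := Real.rpow_lt_rpow (hb.δ_pos (i + 1)).le hlt hp0
      linarith) h2 (by
      intro x hx
      rw [h1]
      have := chord_rpow_lt (by linarith) (hb.δ_pos (i + 1)) hlt (hb.line_at_succ hp0 i) hx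
      linarith)
    rwa [h1] at h3
  have main : ∀ i, W (δ i ^ p / 2) = δ i ∧
      Tendsto D (𝓝[<] (δ i ^ p / 2)) (𝓝 ((2 + a i) / (p * δ i ^ (p - 1)))) := by
    intro i
    induction i with
    | zero =>
      rw [hb.1, hb.2.1]
      have h1 := h.tendsto_D_left_s₀ hp0
      refine ⟨by simpa using h.W_s₀, ?_⟩
      convert h1 using 2 <;> norm_num
    | succ i ih =>
      obtain ⟨h1, h2⟩ := step i ih.1 ih.2
      have hlt := (hb.2.2 i).1.2
      have hδ := hb.δ_pos i
      have hδ' := hb.δ_pos (i + 1)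
      have hle : δ (i + 1) ^ p / 2 ≤ δ i ^ p / 2 := by
        have := Real.rpow_lt_rpow (hb.δ_pos (i + 1)).le hlt hp0
        linarith
      have hW : W (δ (i + 1) ^ p / 2) = δ (i + 1) := by
        rw [h1 _ ⟨le_rfl, hle⟩, hb.line_at_succ hp0 i]
      have ha := (hb.2.2 i).2.2.1
      have ha' := hb.a_pos (i + 1)
      rw [Real.div_rpow hδ'.le hδ.le] at ha
      have hq : 0 < δ i ^ (p - 1) := by positivity
      have hq' : 0 < δ (i + 1) ^ (p - 1) := by positivity
      have hval : p * δ (i + 1) ^ (p - 1) * ((2 + a i) / (p * δ i ^ (p - 1))) = 2 - a (i + 1) := by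
        rw [ha]; field_simp; ring
      have h3 := h.tendsto_D_left_of_right hp0 (hs (i + 1)) (by rw [hW]; ring) h2
        (by rw [hW, hval]; linarith)
      refine ⟨hW, ?_⟩
      convert h3 using 2
      have hval' : (2 + a i) / (p * δ i ^ (p - 1)) =
          (2 - a (i + 1)) / (p * δ (i + 1) ^ (p - 1)) := by
        rw [eq_div_iff (by positivity)]
        linarith
      rw [hW, eq_sub_iff_add_eq, hval', ← add_div]
      congr 1
      ring
  exact (step j (main j).1 (main j).2).1
end

section
open Set Topology

/-- Elementary bounds for a positive concave function on `(0, ∞)` vanishing at `0` and with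
limit `1` at infinity. -/
lemma concave_bounds {w v G : ℝ → ℝ} (hw : ∀ s, 0 < s → HasDerivAt w (v s) s)
    (hv : ∀ s, 0 < s → HasDerivAt v (-(G s)) s) (hG : ∀ s, 0 < s → 0 ≤ G s)
    (hpos : ∀ s, 0 < s → 0 < w s) (hcont : ContinuousOn w (Ici 0)) (h0 : w 0 = 0)
    (hlim : Tendsto w atTop (𝓝 1)) :
    (∀ s, 0 < s → 0 ≤ v s) ∧ (∀ s, 0 < s → w s ≤ 1) ∧ ∀ s, 0 < s → s * v s ≤ w s := by
  have hanti : ∀ a b, 0 < a → a < b → v b ≤ v a := by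
    intro a b ha hab
    obtain ⟨c, hc, h⟩ := exists_sub_eq_mul_of_pos ha hab hv
    nlinarith [hG c (ha.trans hc.1)]
  have hvnn : ∀ s, 0 < s → 0 ≤ v s := by
    intro s hs
    by_contra! hneg
    have hws := hpos s hs
    have hlen : 0 < w s / -v s := div_pos hws (by linarith)
    obtain ⟨c, hc, h⟩ := exists_sub_eq_mul_of_pos hs (lt_add_of_pos_right s hlen) hw
    have h1 := hanti s c hs hc.1
    have h2 := hpos (s + w s / -v s) (by linarith)
    have h3 : w s / -v s * v s = -w s := by field_simp [hneg.ne]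
    rw [add_sub_cancel_left] at h
    have h4 := mul_le_mul_of_nonneg_left h1 hlen.le
    linarith
  refine ⟨hvnn, fun s hs => ?_, fun s hs => ?_⟩
  · refine ge_of_tendsto hlim ?_
    filter_upwards [eventually_gt_atTop s] with t ht
    obtain ⟨c, hc, h⟩ := exists_sub_eq_mul_of_pos hs ht hw
    nlinarith [hvnn c (hs.trans hc.1)]
  · obtain ⟨c, hc, h⟩ := exists_hasDerivAt_eq_slope w v hs
      (hcont.mono fun x hx => hx.1) (fun x hx => hw x hx.1)
    have h1 := hanti c s hc.1 hc.2
    rw [h0, sub_zero, sub_zero] at h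
    rw [h, le_div_iff₀ hs] at h1
    linarith

/-- A solution in the variable `s = log (1/r) / μ ^ p`, normalized by its maximum `μ`. -/
noncomputable def scaledSol (p μ : ℝ) (u : ℝ → ℝ) (s : ℝ) : ℝ :=
  u (Real.exp (-(μ ^ p * s))) / μ

/-- The derivative of `scaledSol`. -/
noncomputable def scaledSlope (p μ : ℝ) (u : ℝ → ℝ) (s : ℝ) : ℝ :=
  -(μ ^ p / μ) * (Real.exp (-(μ ^ p * s)) * deriv u (Real.exp (-(μ ^ p * s))))

/-- Minus the second derivative of `scaledSol`. -/
noncomputable def scaledDensity (p μ lam : ℝ) (f u : ℝ → ℝ) (s : ℝ) : ℝ :=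
  (μ ^ p) ^ 2 / μ * lam * (Real.exp (-(μ ^ p * s)) ^ 2 * f (u (Real.exp (-(μ ^ p * s)))))

/-- The normalized logarithmic derivative of the nonlinearity `h t * exp (t ^ p)`. -/
noncomputable def scaledRate (p μ : ℝ) (h u : ℝ → ℝ) (s : ℝ) : ℝ :=
  μ / μ ^ p * (deriv h (u (Real.exp (-(μ ^ p * s)))) / h (u (Real.exp (-(μ ^ p * s)))) +
    p * u (Real.exp (-(μ ^ p * s))) ^ (p - 1))

lemma exp_neg_mul_mem_Ioo {M s : ℝ} (hM : 0 < M) (hs : 0 < s) :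
    Real.exp (-(M * s)) ∈ Ioo (0 : ℝ) 1 :=
  ⟨Real.exp_pos _, Real.exp_lt_one_iff.2 (neg_lt_zero.2 (mul_pos hM hs))⟩

lemma hasDerivAt_exp_neg_mul (M s : ℝ) :
    HasDerivAt (fun s => Real.exp (-(M * s))) (-(M * Real.exp (-(M * s)))) s := by
  refine (((hasDerivAt_id s).const_mul M).neg.exp).congr_deriv ?_
  simp only [id, mul_one, Pi.neg_apply]
  ring

section OneSolution

variable {p μ lam : ℝ} {f u h : ℝ → ℝ}

lemma hasDerivAt_of_contDiffOn_two (hu : ContDiffOn ℝ 2 u (Icc 0 1)) {r : ℝ} (hr : r ∈ Ioo 0 1) :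
    HasDerivAt u (deriv u r) r ∧ HasDerivAt (deriv u) (deriv (deriv u) r) r := by
  have hu' := hu.mono Ioo_subset_Icc_self
  refine ⟨((hu'.differentiableOn (by norm_num)).differentiableAt (isOpen_Ioo.mem_nhds hr)).hasDerivAt,
    ?_⟩
  have h1 : ContDiffOn ℝ 1 (deriv u) (Ioo 0 1) :=
    hu'.deriv_of_isOpen isOpen_Ioo (by norm_num)
  exact ((h1.differentiableOn (by norm_num)).differentiableAt (isOpen_Ioo.mem_nhds hr)).hasDerivAt

lemma hasDerivAt_scaledSol (hμ : 0 < μ) (hu : ContDiffOn ℝ 2 u (Icc 0 1)) {s : ℝ} (hs : 0 < s) :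
    HasDerivAt (scaledSol p μ u) (scaledSlope p μ u s) s := by
  have hM : 0 < μ ^ p := Real.rpow_pos_of_pos hμ p
  have h1 := (hasDerivAt_of_contDiffOn_two hu (exp_neg_mul_mem_Ioo hM hs)).1
  refine ((h1.comp s (hasDerivAt_exp_neg_mul (μ ^ p) s)).div_const μ).congr_deriv ?_
  rw [scaledSlope]
  ring

lemma hasDerivAt_scaledSlope (hμ : 0 < μ) (hu : ContDiffOn ℝ 2 u (Icc 0 1))
    (heq : ∀ r ∈ Ioo (0 : ℝ) 1, -(deriv (deriv u) r) - deriv u r / r = lam * f (u r))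
    {s : ℝ} (hs : 0 < s) :
    HasDerivAt (scaledSlope p μ u) (-(scaledDensity p μ lam f u s)) s := by
  have hM : 0 < μ ^ p := Real.rpow_pos_of_pos hμ p
  have hr := exp_neg_mul_mem_Ioo hM hs
  have h1 := (hasDerivAt_of_contDiffOn_two hu hr).2
  have he := hasDerivAt_exp_neg_mul (μ ^ p) s
  have heq' := heq _ hr
  refine ((he.mul (h1.comp s he)).const_mul (-(μ ^ p / μ))).congr_deriv ?_
  rw [scaledDensity]
  simp only [Function.comp]
  set r := Real.exp (-(μ ^ p * s)) with hr_def
  have hr0 : r ≠ 0 := hr.1.ne'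
  field_simp at heq' ⊢
  linear_combination -heq'

lemma scaledSol_bounds (hμ : 0 < μ) (hlam : 0 < lam)
    (hu : ContDiffOn ℝ 2 u (Icc 0 1)) (hupos : ∀ r ∈ Ico (0 : ℝ) 1, 0 < u r) (hu0 : u 0 = μ)
    (hu1 : u 1 = 0) (hf : ∀ t, 0 < t → 0 ≤ f t)
    (heq : ∀ r ∈ Ioo (0 : ℝ) 1, -(deriv (deriv u) r) - deriv u r / r = lam * f (u r)) :
    (∀ s, 0 < s → 0 ≤ scaledSlope p μ u s) ∧ (∀ s, 0 < s → scaledSol p μ u s ≤ 1) ∧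
      ∀ s, 0 < s → s * scaledSlope p μ u s ≤ scaledSol p μ u s := by
  have hM : 0 < μ ^ p := Real.rpow_pos_of_pos hμ p
  have hposu : ∀ s, 0 < s → 0 < u (Real.exp (-(μ ^ p * s))) := fun s hs =>
    hupos _ ⟨(Real.exp_pos _).le, (exp_neg_mul_mem_Ioo hM hs).2⟩
  refine concave_bounds (fun s hs => hasDerivAt_scaledSol hμ hu hs)
    (fun s hs => hasDerivAt_scaledSlope hμ hu heq hs) (fun s hs => ?_)
    (fun s hs => div_pos (hposu s hs) hμ) ?_ ?_ ?_
  · have := hf _ (hposu s hs)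
    rw [scaledDensity]
    positivity
  · refine ContinuousOn.div_const (hu.continuousOn.comp (by fun_prop) fun s hs => ?_) μ
    have : 0 ≤ μ ^ p * s := mul_nonneg hM.le hs
    exact ⟨(Real.exp_pos _).le, Real.exp_le_one_iff.2 (by linarith)⟩
  · simp [scaledSol, hu1]
  · have h1 : Tendsto (fun s => Real.exp (-(μ ^ p * s))) atTop (𝓝[Icc 0 1] 0) := by
      refine tendsto_nhdsWithin_iff.2 ⟨?_, ?_⟩
      · exact Real.tendsto_exp_atBot.comp
          (tendsto_neg_atTop_atBot.comp (tendsto_id.const_mul_atTop hM))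
      · filter_upwards [eventually_gt_atTop 0] with s hs
        exact Ioo_subset_Icc_self (exp_neg_mul_mem_Ioo hM hs)
    have h2 := ((hu.continuousOn 0 (by simp)).tendsto.comp h1).div_const μ
    rw [hu0, div_self hμ.ne'] at h2
    exact h2

lemma hasDerivAt_scaledDensity (hμ : 0 < μ) (hu : ContDiffOn ℝ 2 u (Icc 0 1))
    (hh : ContDiffOn ℝ 1 h (Ici 0)) (hf : ∀ t, f t = h t * Real.exp (t ^ p)) {s : ℝ} (hs : 0 < s)
    (hx : 0 < u (Real.exp (-(μ ^ p * s)))) (hhx : 0 < h (u (Real.exp (-(μ ^ p * s))))) :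
    HasDerivAt (scaledDensity p μ lam f u) (μ ^ p * scaledDensity p μ lam f u s *
      (scaledRate p μ h u s * scaledSlope p μ u s - 2)) s := by
  have hM : 0 < μ ^ p := Real.rpow_pos_of_pos hμ p
  have hr := exp_neg_mul_mem_Ioo hM hs
  have h1 := (hasDerivAt_of_contDiffOn_two hu hr).1
  have he := hasDerivAt_exp_neg_mul (μ ^ p) s
  have hhd : HasDerivAt h (deriv h (u (Real.exp (-(μ ^ p * s)))))
      (u (Real.exp (-(μ ^ p * s)))) :=
    ((hh.differentiableOn (by norm_num)).differentiableAt (Ici_mem_nhds hx)).hasDerivAt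
  have hfd := hhd.mul (((hasDerivAt_id (u (Real.exp (-(μ ^ p * s))))).rpow_const
    (p := p) (Or.inl hx.ne')).exp)
  have hfeq : f = h * fun t => Real.exp (id t ^ p) := by
    funext t
    simp [hf t]
  rw [← hfeq] at hfd
  have hcomp := hfd.comp s (h1.comp s he)
  refine (((he.pow 2).mul hcomp).const_mul ((μ ^ p) ^ 2 / μ * lam)).congr_deriv ?_
  rw [scaledDensity, scaledRate, scaledSlope]
  simp only [Function.comp, hf, id, Pi.pow_apply]
  field_simp
  norm_num
  ring

lemma scaledRate_sub (hμ : 0 < μ) {s : ℝ} (hx : 0 < u (Real.exp (-(μ ^ p * s)))) :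
    scaledRate p μ h u s - p * scaledSol p μ u s ^ (p - 1) =
      scaledSol p μ u s ^ (p - 1) * (deriv h (u (Real.exp (-(μ ^ p * s)))) /
        (u (Real.exp (-(μ ^ p * s))) ^ (p - 1) * h (u (Real.exp (-(μ ^ p * s)))))) := by
  rw [scaledRate, scaledSol, Real.div_rpow hx.le hμ.le, Real.rpow_sub_one hμ.ne' p]
  have h1 : 0 < u (Real.exp (-(μ ^ p * s))) ^ (p - 1) := by positivity
  have h2 : 0 < μ ^ p := by positivity
  by_cases hh : h (u (Real.exp (-(μ ^ p * s)))) = 0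
  · simp only [hh, div_zero, mul_zero, zero_add]
    field_simp
    ring
  · field_simp
    ring

end OneSolution

lemma rpow_le_one_add_rpow {x η q : ℝ} (hη : 0 < η) (hx : η ≤ x) (hx1 : x ≤ 1) :
    x ^ q ≤ 1 + η ^ q := by
  have h1 : 0 < η ^ q := by positivity
  rcases le_total 0 q with hq | hq
  · have := Real.rpow_le_one (hη.le.trans hx) hx1 hq
    linarith
  · have := Real.rpow_le_rpow_of_nonpos hη hx hq
    linarith

/-- Rescaling a sequence of solutions whose maxima `μ n` diverge. -/
theorem isRescaledSeq_of_solutions {p s₀ : ℝ} (hp : 0 < p) (hs₀ : 0 < s₀) {h f : ℝ → ℝ}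
    (hhC1 : ContDiffOn ℝ 1 h (Ici 0)) (hhnonneg : ∀ t : ℝ, 0 ≤ t → 0 ≤ h t)
    {t₀ : ℝ} (hhpos : ∀ t : ℝ, t₀ ≤ t → 0 < h t)
    (hf : ∀ t : ℝ, f t = h t * Real.exp (t ^ p))
    (H1 : Tendsto (fun t : ℝ => deriv h t / (t ^ (p - 1) * h t)) atTop (𝓝 0))
    {lam μ : ℕ → ℝ} {u : ℕ → ℝ → ℝ} (hlam : ∀ n, 0 < lam n) (hμ : ∀ n, 0 < μ n)
    (huC2 : ∀ n, ContDiffOn ℝ 2 (u n) (Icc 0 1)) (hupos : ∀ n, ∀ r ∈ Ico (0 : ℝ) 1, 0 < u n r)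
    (hu0 : ∀ n, u n 0 = μ n) (hu1 : ∀ n, u n 1 = 0)
    (heq : ∀ n, ∀ r ∈ Ioo (0 : ℝ) 1,
      -(deriv (deriv (u n)) r) - deriv (u n) r / r = lam n * f (u n r))
    (hmuInf : Tendsto μ atTop atTop)
    {r₀ : ℕ → ℝ} (hr₀mem : ∀ n, r₀ n ∈ Ioo (0 : ℝ) 1)
    (hr₀u : Tendsto (fun n => u n (r₀ n) / μ n) atTop (𝓝 1))
    (hr₀phi : Tendsto (fun n =>
        p * lam n * (r₀ n) ^ 2 * (u n (r₀ n)) ^ (p - 1) * f (u n (r₀ n))) atTop (𝓝 2))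
    (hr₀osc : Tendsto (fun n => (u n (r₀ n)) ^ p / Real.log (1 / r₀ n)) atTop (𝓝 (1 / s₀))) :
    IsRescaledSeq p s₀ (fun n => μ n ^ p) (fun n => scaledSol p (μ n) (u n))
      (fun n => scaledSlope p (μ n) (u n)) (fun n => scaledDensity p (μ n) (lam n) f (u n))
      (fun n => scaledRate p (μ n) h (u n)) := by
  have hM : ∀ n, 0 < μ n ^ p := fun n => Real.rpow_pos_of_pos (hμ n) p
  have hMlim : Tendsto (fun n => μ n ^ p) atTop atTop := (tendsto_rpow_atTop hp).comp hmuInf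
  have hposu : ∀ n s, 0 < s → 0 < u n (Real.exp (-(μ n ^ p * s))) := fun n s hs =>
    hupos n _ ⟨(Real.exp_pos _).le, (exp_neg_mul_mem_Ioo (hM n) hs).2⟩
  have hfnn : ∀ t, 0 < t → 0 ≤ f t := fun t ht => by
    rw [hf]; exact mul_nonneg (hhnonneg t ht.le) (Real.exp_pos _).le
  have hbd := fun n => scaledSol_bounds (p := p) (hμ n) (hlam n) (huC2 n) (hupos n) (hu0 n) (hu1 n)
    hfnn (heq n)
  have hlarge : ∀ X η, 0 < η → ∀ᶠ n in atTop, ∀ s, η ≤ scaledSol p (μ n) (u n) s →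
      X ≤ u n (Real.exp (-(μ n ^ p * s))) := by
    intro X η hη
    filter_upwards [hmuInf.eventually_ge_atTop (X / η)] with n hn s hs
    rw [scaledSol, le_div_iff₀ (hμ n)] at hs
    rw [div_le_iff₀ hη] at hn
    linarith
  refine ⟨hMlim, fun n s hs => hasDerivAt_scaledSol (hμ n) (huC2 n) hs,
    fun n s hs => hasDerivAt_scaledSlope (hμ n) (huC2 n) (heq n) hs, fun n s hs => ?_,
    fun n => (hbd n).1, fun n s hs => div_pos (hposu n s hs) (hμ n), fun n => (hbd n).2.1,
    fun n => (hbd n).2.2, fun η hη => ?_, fun ε hε η hη => ?_, hs₀, ?_⟩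
  · have := hfnn _ (hposu n s hs)
    have := hμ n
    have := hlam n
    simp only [scaledDensity]
    positivity
  · filter_upwards [hlarge t₀ η hη] with n hn s hs hws
    have hhx := hhpos _ (hn s hws)
    refine ⟨?_, hasDerivAt_scaledDensity (hμ n) (huC2 n) hhC1 hf hs (hposu n s hs) hhx⟩
    have := hμ n
    have := hlam n
    rw [scaledDensity, hf]
    positivity
  · have hC : 0 < 1 + η ^ (p - 1) := by positivity
    obtain ⟨X, hX⟩ := (Metric.tendsto_atTop.1 H1) (ε / (1 + η ^ (p - 1))) (div_pos hε hC)
    filter_upwards [hlarge X η hη] with n hn s hs hws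
    have h1 := hX _ (hn s hws)
    have hw0 : 0 < scaledSol p (μ n) (u n) s := hη.trans_le hws
    rw [Real.dist_eq, sub_zero] at h1
    rw [scaledRate_sub (hμ n) (hposu n s hs), abs_mul, abs_of_pos (by positivity)]
    calc _ ≤ (1 + η ^ (p - 1)) * (ε / (1 + η ^ (p - 1))) :=
          mul_le_mul (rpow_le_one_add_rpow hη hws ((hbd n).2.1 s hs)) h1.le (abs_nonneg _) hC.le
      _ = ε := by field_simp
  · have hlog : ∀ n, 0 < Real.log (1 / r₀ n) := fun n =>
      Real.log_pos ((one_lt_div (hr₀mem n).1).2 (hr₀mem n).2)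
    have hexp : ∀ n, Real.exp (-(μ n ^ p * (Real.log (1 / r₀ n) / μ n ^ p))) = r₀ n := by
      intro n
      rw [mul_div_cancel₀ _ (hM n).ne', one_div, Real.log_inv, neg_neg,
        Real.exp_log (hr₀mem n).1]
    have hu₀ : ∀ n, 0 < u n (r₀ n) := fun n => hupos n _ ⟨(hr₀mem n).1.le, (hr₀mem n).2⟩
    have hsol : ∀ n, scaledSol p (μ n) (u n) (Real.log (1 / r₀ n) / μ n ^ p) =
        u n (r₀ n) / μ n := fun n => by rw [scaledSol, hexp]
    refine ⟨fun n => Real.log (1 / r₀ n) / μ n ^ p, ?_, ?_, ?_⟩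
    · have h1 := (hr₀u.rpow_const (p := p) (Or.inl one_ne_zero)).div hr₀osc
        (one_div_ne_zero hs₀.ne')
      rw [Real.one_rpow, one_div_one_div] at h1
      refine h1.congr fun n => ?_
      have := hu₀ n
      have := hlog n
      have := hM n
      simp only [Pi.div_apply]
      rw [Real.div_rpow (hu₀ n).le (hμ n).le]
      have : 0 < u n (r₀ n) ^ p := by positivity
      field_simp
    · simpa only [hsol] using hr₀u
    · have hq : Tendsto (fun n => Real.log ((p * lam n * (r₀ n) ^ 2 * (u n (r₀ n)) ^ (p - 1) *
          f (u n (r₀ n))) / (p * (u n (r₀ n) / μ n) ^ (p - 1)))) atTop (𝓝 (Real.log (2 / p))) := by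
        have h1 := (hr₀u.rpow_const (p := p - 1) (Or.inl one_ne_zero)).const_mul p
        rw [Real.one_rpow, mul_one] at h1
        exact (hr₀phi.div h1 hp.ne').log (by positivity)
      have h2 : Tendsto (fun n => Real.log (μ n ^ p) / μ n ^ p) atTop (𝓝 0) := by
        have := (Real.isLittleO_log_id_atTop.tendsto_div_nhds_zero).comp hMlim
        exact this
      have h3 := (hq.div_atTop hMlim).add h2
      rw [add_zero] at h3
      refine h3.congr' ?_
      filter_upwards [hr₀phi.eventually (lt_mem_nhds two_pos)] with n hn
      have hu := hu₀ n
      have hμn := hμ n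
      have hMn := hM n
      have hpw : 0 < (u n (r₀ n) / μ n) ^ (p - 1) := by positivity
      rw [← add_div, ← Real.log_mul (div_pos hn (by positivity)).ne' hMn.ne']
      congr 2
      rw [scaledDensity, hexp, Real.div_rpow hu.le hμn.le, Real.rpow_sub_one hμn.ne']
      have : 0 < u n (r₀ n) ^ (p - 1) := by positivity
      field_simp
end

section
open Set Topology

namespace ZeroCountAtLeast

variable {I J : Set ℝ} {v : ℝ → ℝ} {N : ℕ} {x y : ℝ}

lemma mono (h : ZeroCountAtLeast I v N) (hIJ : I ⊆ J) : ZeroCountAtLeast J v N := by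
  obtain ⟨S, hS, hc⟩ := h
  exact ⟨S, fun z hz => ⟨hIJ (hS hz).1, (hS hz).2⟩, hc⟩

lemma of_zero (hx : x ∈ I) (hv : v x = 0) : ZeroCountAtLeast I v 1 :=
  ⟨{x}, by simpa using ⟨hx, hv⟩, by simp⟩

lemma succ_of_lt (h : ZeroCountAtLeast (Ioc 0 x) v N) (hx : 0 < x) (hxy : x < y)
    (hv : v y = 0) : ZeroCountAtLeast (Ioc 0 y) v (N + 1) := by
  obtain ⟨S, hS, hc⟩ := h
  have hy : y ∉ S := fun hy => absurd (hS hy).1.2 (not_le.2 hxy)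
  refine ⟨insert y S, ?_, by rw [Finset.card_insert_of_notMem hy]; omega⟩
  intro z hz
  rcases Finset.mem_insert.1 (Finset.mem_coe.1 hz) with rfl | hz
  · exact ⟨⟨hx.trans hxy, le_rfl⟩, hv⟩
  · exact ⟨⟨(hS hz).1.1, (hS hz).1.2.trans hxy.le⟩, (hS hz).2⟩

end ZeroCountAtLeast

lemma tendsto_Ubeta_zero {p β : ℝ} (hp : 0 < p) (hβ : 0 < β) :
    Tendsto (Ubeta p β) (𝓝[>] 0) atTop := by
  have h1 : Tendsto (fun r : ℝ => Real.log (1 / r)) (𝓝[>] 0) atTop := by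
    simp only [one_div]
    exact Real.tendsto_log_atTop.comp tendsto_inv_nhdsGT_zero
  exact (tendsto_rpow_atTop (one_div_pos.2 hp)).comp (h1.const_mul_atTop hβ)

lemma continuousOn_Ubeta {p : ℝ} (hp : 0 < p) (β : ℝ) : ContinuousOn (Ubeta p β) (Ioi 0) := by
  refine ContinuousOn.rpow_const ?_ fun x _ => Or.inr (one_div_pos.2 hp).le
  refine continuousOn_const.mul (ContinuousOn.log ?_ ?_)
  · exact continuousOn_const.div continuousOn_id fun x hx => (ne_of_gt hx)
  · exact fun x hx => one_div_ne_zero (ne_of_gt hx)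

/-- A function that lies above `U_β` at `x` crosses it in `(0, x]`. -/
lemma zeroCountAtLeast_one_of_Ubeta_lt {p β : ℝ} (hp : 0 < p) (hβ : 0 < β) {u : ℝ → ℝ}
    (hu : ContinuousOn u (Icc 0 1)) {x : ℝ} (hx : x ∈ Ioo 0 1) (h : Ubeta p β x < u x) :
    ZeroCountAtLeast (Ioc 0 x) (fun r => u r - Ubeta p β r) 1 := by
  obtain ⟨C, hC⟩ := isCompact_Icc.bddAbove_image hu
  obtain ⟨y, hy1, hy⟩ := (((tendsto_Ubeta_zero hp hβ).eventually_gt_atTop C).and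
    (Ioo_mem_nhdsGT hx.1)).exists
  have hcont : ContinuousOn (fun r => u r - Ubeta p β r) (Icc y x) :=
    (hu.mono (Icc_subset_Icc hy.1.le hx.2.le)).sub
      ((continuousOn_Ubeta hp β).mono fun z hz => hy.1.trans_le hz.1)
  have hyC : u y ≤ C := hC ⟨y, ⟨hy.1.le, (hy.2.trans hx.2).le⟩, rfl⟩
  obtain ⟨z, hz, hz0⟩ := intermediate_value_Icc hy.2.le hcont
    (show (0 : ℝ) ∈ Icc (u y - Ubeta p β y) (u x - Ubeta p β x) from
      ⟨by linarith, by linarith⟩)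
  exact .of_zero ⟨hy.1.trans_le hz.1, hz.2⟩ hz0

/-- In a sequence of sets eventually meeting every neighbourhood of a point one can choose
elements converging to that point. -/
lemma exists_tendsto_of_eventually_exists {P : ℕ → ℝ → Prop} {s : ℝ}
    (h : ∀ ρ, 0 < ρ → ∀ᶠ n in atTop, ∃ x ∈ Ioo (s - ρ) (s + ρ), P n x) :
    ∃ σ : ℕ → ℝ, Tendsto σ atTop (𝓝 s) ∧ ∀ᶠ n in atTop, P n (σ n) := by
  have hex : ∀ n : ℕ, ∃ y, (∃ x, P n x) →
      P n y ∧ dist s y < Metric.infDist s {x | P n x} + 1 / ((n : ℝ) + 1) := by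
    intro n
    by_cases hn : ∃ x, P n x
    · obtain ⟨y, hy, hd⟩ := (Metric.infDist_lt_iff (x := s) (s := {x | P n x}) hn).1
        (lt_add_of_pos_right _ (Nat.one_div_pos_of_nat (α := ℝ) (n := n)))
      exact ⟨y, fun _ => ⟨hy, hd⟩⟩
    · exact ⟨s, fun hn' => absurd hn' hn⟩
  choose σ hσ using hex
  have hP : ∀ᶠ n in atTop, ∃ x, P n x := by
    filter_upwards [h 1 one_pos] with n ⟨x, _, hx⟩ using ⟨x, hx⟩
  refine ⟨σ, Metric.tendsto_nhds.2 fun ε hε => ?_, hP.mono fun n hn => (hσ n hn).1⟩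
  filter_upwards [h (ε / 2) (half_pos hε), hP,
    tendsto_one_div_add_atTop_nhds_zero_nat.eventually (gt_mem_nhds (half_pos hε))]
    with n ⟨x, hx, hPx⟩ hn hn'
  have h1 := (hσ n hn).2
  have h2 : Metric.infDist s {x | P n x} ≤ dist s x := Metric.infDist_le_dist_of_mem hPx
  have h3 : dist s x < ε / 2 := by
    rw [Real.dist_eq, abs_lt]
    constructor <;> linarith [hx.1, hx.2]
  rw [dist_comm]
  linarith

lemma eventually_exists_crossing {w : ℕ → ℝ → ℝ} {g : ℝ → ℝ} {a b A B : ℝ} (hab : a < b)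
    (hw : ∀ n, ContinuousOn (w n) (Icc a b)) (hg : ContinuousOn g (Icc a b))
    (hA : Tendsto (fun n => w n a) atTop (𝓝 A)) (hB : Tendsto (fun n => w n b) atTop (𝓝 B))
    (h : (A - g a) * (B - g b) < 0) : ∀ᶠ n in atTop, ∃ s ∈ Ioo a b, w n s = g s := by
  have hA' := hA.sub_const (g a)
  have hB' := hB.sub_const (g b)
  rcases mul_neg_iff.1 h with ⟨h1, h2⟩ | ⟨h1, h2⟩
  · filter_upwards [hA'.eventually (lt_mem_nhds h1), hB'.eventually (gt_mem_nhds h2)]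
      with n hn1 hn2
    obtain ⟨s, hs, hs0⟩ := intermediate_value_Ioo' hab.le ((hw n).sub hg)
      (show (0 : ℝ) ∈ Ioo (w n b - g b) (w n a - g a) from ⟨hn2, hn1⟩)
    exact ⟨s, hs, sub_eq_zero.1 hs0⟩
  · filter_upwards [hA'.eventually (gt_mem_nhds h1), hB'.eventually (lt_mem_nhds h2)]
      with n hn1 hn2
    obtain ⟨s, hs, hs0⟩ := intermediate_value_Ioo hab.le ((hw n).sub hg)
      (show (0 : ℝ) ∈ Ioo (w n a - g a) (w n b - g b) from ⟨hn1, hn2⟩)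
    exact ⟨s, hs, sub_eq_zero.1 hs0⟩

/-- Crossings of the approximating functions converging to a strict sign change of the limit. -/
lemma exists_tendsto_crossing {w : ℕ → ℝ → ℝ} {g L : ℝ → ℝ} {a b s : ℝ} (hs : s ∈ Ioo a b)
    (hw : ∀ n, ContinuousOn (w n) (Ioo a b)) (hg : ContinuousOn g (Ioo a b))
    (hL : ∀ x ∈ Ioo a b, Tendsto (fun n => w n x) atTop (𝓝 (L x)))
    (hsign : ∀ x ∈ Ioo a s, ∀ y ∈ Ioo s b, (L x - g x) * (L y - g y) < 0) :
    ∃ σ : ℕ → ℝ, Tendsto σ atTop (𝓝 s) ∧ ∀ᶠ n in atTop, w n (σ n) = g (σ n) := by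
  refine exists_tendsto_of_eventually_exists (P := fun n x => w n x = g x) fun ρ hρ => ?_
  obtain ⟨x, hx1, hx2⟩ := exists_between (max_lt hs.1 (sub_lt_self s hρ))
  obtain ⟨y, hy1, hy2⟩ := exists_between (lt_min hs.2 (lt_add_of_pos_right s hρ))
  have hxa := (le_max_left _ _).trans_lt hx1
  have hxρ := (le_max_right _ _).trans_lt hx1
  have hyb := hy2.trans_le (min_le_left _ _)
  have hyρ := hy2.trans_le (min_le_right _ _)
  have hsub : Icc x y ⊆ Ioo a b := fun z hz => ⟨hxa.trans_le hz.1, hz.2.trans_lt hyb⟩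
  filter_upwards [eventually_exists_crossing (hx2.trans hy1) (fun n => (hw n).mono hsub)
    (hg.mono hsub) (hL x ⟨hxa, (hx2.trans hy1).trans hyb⟩) (hL y ⟨hxa.trans (hx2.trans hy1), hyb⟩)
    (hsign x ⟨hxa, hx2⟩ y ⟨hy1, hyb⟩)] with n ⟨z, hz, h⟩
  exact ⟨z, ⟨hxρ.trans hz.1, hz.2.trans hyρ⟩, h⟩

namespace IsRescaledSeq

variable {p s₀ : ℝ} {M : ℕ → ℝ} {w v G Q : ℕ → ℝ → ℝ}

lemma continuousOn_w (hR : IsRescaledSeq p s₀ M w v G Q) (n : ℕ) : ContinuousOn (w n) (Ioi 0) :=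
  fun s hs => (hR.hasDerivAt_w n s hs).continuousAt.continuousWithinAt

lemma tendsto_w_of_profile (hR : IsRescaledSeq p s₀ M w v G Q) (hp : 0 < p) {s A : ℝ}
    (hs : 0 < s) (h : ∀ W D, IsLimitProfile p s₀ W D → W s = A) :
    Tendsto (fun n => w n s) atTop (𝓝 A) := by
  rw [tendsto_iff_ultrafilter]
  intro F hF
  obtain ⟨W, D, hW, hlim⟩ := hR.exists_isLimitProfile hp F hF
  rw [← h W D hW]
  exact hlim s hs

lemma tendsto_w_line (hR : IsRescaledSeq p (p / 4) M w v G Q) (hp : 0 < p) {s : ℝ} (hs : 0 < s)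
    (hs' : s ≤ p / 4) : Tendsto (fun n => w n s) atTop (𝓝 (4 * s / p)) :=
  hR.tendsto_w_of_profile hp hs fun _ _ hW => hW.eq_line hp hs hs'

end IsRescaledSeq

/-- The affine limit of the rescaled solutions between the concentration points `δ (j+1) ^ p / 2`
and `δ j ^ p / 2`. -/
noncomputable def bubbleLine (p : ℝ) (a δ : ℕ → ℝ) (j : ℕ) (x : ℝ) : ℝ :=
  δ j - (2 + a j) / (p * δ j ^ (p - 1)) * (δ j ^ p / 2 - x)

lemma IsRescaledSeq.tendsto_w_bubbleLine {p : ℝ} {M : ℕ → ℝ} {w v G Q : ℕ → ℝ → ℝ}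
    (hR : IsRescaledSeq p (1 / 2) M w v G Q) (hp : 2 < p) {a δ : ℕ → ℝ} (hb : IsBubbleSeq p a δ)
    (j : ℕ) {x : ℝ} (hx : x ∈ Icc (δ (j + 1) ^ p / 2) (δ j ^ p / 2)) :
    Tendsto (fun n => w n x) atTop (𝓝 (bubbleLine p a δ j x)) := by
  have := hb.δ_pos (j + 1)
  exact hR.tendsto_w_of_profile (by linarith) (lt_of_lt_of_le (by positivity) hx.1)
    fun _ _ hW => hW.eq_bubble_line hp hb j x hx

lemma sub_rpow_neg_of_lt {p x y : ℝ} (hp : 0 < p) (hx : 0 ≤ x) (hy : 0 ≤ y) (h : x ^ p < y) :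
    x - y ^ (1 / p) < 0 := by
  rw [sub_neg, one_div]
  exact (Real.lt_rpow_inv_iff_of_pos hx hy hp).2 h

lemma sub_rpow_pos_of_lt {p x y : ℝ} (hp : 0 < p) (hx : 0 ≤ x) (hy : 0 ≤ y) (h : y < x ^ p) :
    0 < x - y ^ (1 / p) := by
  rw [sub_pos, one_div]
  exact (Real.rpow_inv_lt_iff_of_pos hy hx hp).2 h

lemma affine_rpow_lt {p c e β m x z : ℝ} (hp : 1 ≤ p) (hm : 0 ≤ c + e * m) (hx : 0 ≤ c + e * x)
    (hm' : (c + e * m) ^ p < β * m) (hx' : (c + e * x) ^ p ≤ β * x)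
    (hz : z ∈ Ioo m x ∨ z ∈ Ioo x m) : (c + e * z) ^ p < β * z := by
  obtain ⟨t, ht0, ht1, rfl⟩ : ∃ t : ℝ, 0 < t ∧ t < 1 ∧ z = (1 - t) * m + t * x := by
    rcases hz with hz | hz
    · have hd : 0 < x - m := by linarith [hz.1, hz.2]
      refine ⟨(z - m) / (x - m), div_pos (by linarith [hz.1]) hd,
        (div_lt_one hd).2 (by linarith [hz.2]), ?_⟩
      field_simp
      ring
    · have hd : 0 < m - x := by linarith [hz.1, hz.2]
      refine ⟨(m - z) / (m - x), div_pos (by linarith [hz.2]) hd,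
        (div_lt_one hd).2 (by linarith [hz.1]), ?_⟩
      field_simp
      ring
  have key := (convexOn_rpow hp).2 (mem_Ici.2 hm) (mem_Ici.2 hx) (sub_pos.2 ht1).le ht0.le
    (by ring)
  simp only [smul_eq_mul] at key
  have h1 : c + e * ((1 - t) * m + t * x) = (1 - t) * (c + e * m) + t * (c + e * x) := by ring
  rw [h1]
  nlinarith [mul_lt_mul_of_pos_left hm' (sub_pos.2 ht1), mul_le_mul_of_nonneg_left hx' ht0.le]

lemma two_mul_one_sub_rpow_le {p x : ℝ} (hp : 2 < p) (hx : x ∈ Ioo (0 : ℝ) 1) :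
    2 * (1 - x ^ p) ≤ p * (1 - x) * (1 + x ^ (p - 1)) := by
  have hder : ∀ y : ℝ, 0 < y → HasDerivAt
      (fun y : ℝ => p * (1 - y) * (1 + y ^ (p - 1)) - 2 * (1 - y ^ p))
      (p * (-1 + (p - 1) * y ^ (p - 2) - (p - 2) * y ^ (p - 1))) y := by
    intro y hy
    have h1 : HasDerivAt (fun y : ℝ => y ^ (p - 1)) ((p - 1) * y ^ (p - 2)) y := by
      convert Real.hasDerivAt_rpow_const (p := p - 1) (Or.inl hy.ne') using 3
      ring
    have h2 : HasDerivAt (fun y : ℝ => y ^ p) (p * y ^ (p - 1)) y :=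
      Real.hasDerivAt_rpow_const (Or.inl hy.ne')
    refine (((((hasDerivAt_id y).const_sub 1).const_mul p).mul (h1.const_add 1)).sub
      ((h2.const_sub 1).const_mul 2)).congr_deriv ?_
    have h3 : y ^ (p - 1) = y ^ (p - 2) * y := by
      rw [← Real.rpow_add_one hy.ne']; ring_nf
    simp only [id, h3]
    ring
  have hanti : AntitoneOn (fun y : ℝ => p * (1 - y) * (1 + y ^ (p - 1)) - 2 * (1 - y ^ p))
      (Ioi 0) := by
    refine antitoneOn_of_deriv_nonpos (convex_Ioi 0)
      (fun y hy => (hder y hy).continuousAt.continuousWithinAt)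
      (fun y hy => (hder y (interior_subset hy)).differentiableAt.differentiableWithinAt)
      fun y hy => ?_
    have hy0 : 0 < y := interior_subset hy
    rw [(hder y hy0).deriv]
    refine mul_nonpos_of_nonneg_of_nonpos (by linarith) ?_
    have h1 := one_add_mul_self_le_rpow_one_add (s := 1 / y - 1) (p := p - 1)
      (by have := one_div_pos.2 hy0; linarith) (by linarith)
    rw [add_sub_cancel, Real.div_rpow zero_le_one hy0.le, Real.one_rpow,
      le_div_iff₀ (by positivity)] at h1
    have h3 : y ^ (p - 1) = y ^ (p - 2) * y := by
      rw [← Real.rpow_add_one hy0.ne']; ring_nf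
    have h4 : (1 + (p - 1) * (1 / y - 1)) * y ^ (p - 1) =
        (p - 1) * y ^ (p - 2) - (p - 2) * y ^ (p - 1) := by
      rw [h3]; field_simp; ring
    linarith
  have := hanti (mem_Ioi.2 hx.1) (mem_Ioi.2 one_pos) hx.2.le
  simp only [Real.one_rpow] at this
  linarith

/-- The threshold `(2 + a) (1 - a / (2 (p - 1))) ^ (p - 1)` is decreasing in `a`. -/
lemma threshold_le {p a a' : ℝ} (hp : 2 < p) (ha' : 0 < a') (haa : a' ≤ a) (ha : a ≤ 2) :
    (2 + a) * (1 - a / (2 * (p - 1))) ^ (p - 1) ≤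
      (2 + a') * (1 - a' / (2 * (p - 1))) ^ (p - 1) := by
  have hq : 0 < 2 * (p - 1) := by linarith
  have hy : 0 < 1 - a / (2 * (p - 1)) := by
    rw [sub_pos, div_lt_one hq]; linarith
  have hy' : 0 < 1 - a' / (2 * (p - 1)) := by
    rw [sub_pos, div_lt_one hq]; linarith
  set y := 1 - a / (2 * (p - 1)) with hydef
  set y' := 1 - a' / (2 * (p - 1)) with hydef'
  have h1 := one_add_mul_self_le_rpow_one_add (s := y' / y - 1) (p := p - 1)
    (by have := div_pos hy' hy; linarith) (by linarith)
  rw [add_sub_cancel, Real.div_rpow hy'.le hy.le, le_div_iff₀ (by positivity)] at h1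
  have h2 : (p - 1) * (y' / y - 1) = (a - a') / (2 * y) := by
    have : y' - y = (a - a') / (2 * (p - 1)) := by rw [hydef, hydef']; ring
    have hp1 : p - 1 ≠ 0 := by linarith
    rw [div_sub_one hy.ne', this]
    field_simp
  rw [h2] at h1
  have h3 : 2 + a ≤ (2 + a') * (1 + (a - a') / (2 * y)) := by
    have h4 : 2 * y ≤ 2 + a' := by
      have : 0 ≤ a / (2 * (p - 1)) := div_nonneg (by linarith) hq.le
      linarith
    have h5 : a - a' ≤ (2 + a') * ((a - a') / (2 * y)) := by
      rw [mul_div_assoc', le_div_iff₀ (by linarith)]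
      nlinarith
    linarith
  calc (2 + a) * y ^ (p - 1) ≤ (2 + a') * (1 + (a - a') / (2 * y)) * y ^ (p - 1) := by gcongr
    _ = (2 + a') * ((1 + (a - a') / (2 * y)) * y ^ (p - 1)) := by ring
    _ ≤ _ := by gcongr

namespace IsBubbleSeq

variable {p : ℝ} {a δ : ℕ → ℝ}

lemma a_succ_le (h : IsBubbleSeq p a δ) (hp : 2 < p) (j : ℕ) : a (j + 1) ≤ a j := by
  obtain ⟨h1, h2, h3, -⟩ := h.2.2 j
  have hδ := h.δ_pos j
  have ha := h.a_pos j
  set x := δ (j + 1) / δ j with hx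
  have hx0 : x ∈ Ioo (0 : ℝ) 1 := ⟨div_pos h1.1 hδ, (div_lt_one hδ).2 h1.2⟩
  have h4 := two_mul_one_sub_rpow_le hp hx0
  have h5 : 2 * p * (1 - x) = (2 + a j) * (1 - x ^ p) := by
    field_simp at h2
    linarith
  have h6 : 0 < 1 - x ^ p := sub_pos.2 (Real.rpow_lt_one hx0.1.le hx0.2 (by linarith))
  have h7 : 4 * (1 - x ^ p) ≤ (2 + a j) * (1 + x ^ (p - 1)) * (1 - x ^ p) := by
    calc 4 * (1 - x ^ p) ≤ 2 * p * (1 - x) * (1 + x ^ (p - 1)) := by linarith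
      _ = _ := by rw [h5]; ring
  have h8 := le_of_mul_le_mul_right h7 h6
  rw [h3]
  linarith

lemma threshold_mono (h : IsBubbleSeq p a δ) (hp : 2 < p) {j k : ℕ} (hjk : j ≤ k) :
    (2 + a j) * (1 - a j / (2 * (p - 1))) ^ (p - 1) ≤
      (2 + a k) * (1 - a k / (2 * (p - 1))) ^ (p - 1) :=
  threshold_le hp (h.a_pos k) (antitone_nat_of_succ_le (h.a_succ_le hp) hjk) (h.a_le_two j)

end IsBubbleSeq
end

section
open Set Topology

namespace IsBubbleSeq

variable {p : ℝ} {a δ : ℕ → ℝ}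

lemma bubbleLine_eq (p : ℝ) (a δ : ℕ → ℝ) (j : ℕ) (x : ℝ) :
    bubbleLine p a δ j x =
      (δ j - (2 + a j) / (p * δ j ^ (p - 1)) * (δ j ^ p / 2)) +
        (2 + a j) / (p * δ j ^ (p - 1)) * x := by
  rw [bubbleLine]
  ring

lemma slope_pos (h : IsBubbleSeq p a δ) (hp : 0 < p) (j : ℕ) :
    0 < (2 + a j) / (p * δ j ^ (p - 1)) := by
  have := h.δ_pos j
  have := h.a_pos j
  positivity

lemma strictMono_bubbleLine (h : IsBubbleSeq p a δ) (hp : 0 < p) (j : ℕ) :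
    StrictMono (bubbleLine p a δ j) := by
  intro x y hxy
  rw [bubbleLine_eq, bubbleLine_eq]
  have := mul_lt_mul_of_pos_left hxy (h.slope_pos hp j)
  linarith

lemma bubbleLine_self (p : ℝ) (a δ : ℕ → ℝ) (j : ℕ) : bubbleLine p a δ j (δ j ^ p / 2) = δ j := by
  simp [bubbleLine]

lemma bubbleLine_succ (h : IsBubbleSeq p a δ) (hp : 0 < p) (j : ℕ) :
    bubbleLine p a δ j (δ (j + 1) ^ p / 2) = δ (j + 1) :=
  h.line_at_succ hp j

lemma bubbleLine_pos (h : IsBubbleSeq p a δ) (hp : 0 < p) (j : ℕ) {x : ℝ}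
    (hx : δ (j + 1) ^ p / 2 ≤ x) : 0 < bubbleLine p a δ j x :=
  (h.δ_pos (j + 1)).trans_le
    ((h.bubbleLine_succ hp j).symm.le.trans ((h.strictMono_bubbleLine hp j).monotone hx))

lemma bubbleLine_rpow_lt (h : IsBubbleSeq p a δ) (hp : 2 < p) (j : ℕ) {β m x z : ℝ}
    (hm : δ (j + 1) ^ p / 2 ≤ m) (hx : δ (j + 1) ^ p / 2 ≤ x)
    (hm' : bubbleLine p a δ j m ^ p < β * m) (hx' : bubbleLine p a δ j x ^ p ≤ β * x)
    (hz : z ∈ Ioo m x ∨ z ∈ Ioo x m) : bubbleLine p a δ j z ^ p < β * z := by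
  have h1 := (h.bubbleLine_pos (by linarith) j hm).le
  have h2 := (h.bubbleLine_pos (by linarith) j hx).le
  rw [bubbleLine_eq] at *
  exact affine_rpow_lt (by linarith) h1 h2 hm' hx' hz

lemma lt_bubbleLine_rpow (h : IsBubbleSeq p a δ) (hp : 2 < p) (j : ℕ) {β m x z : ℝ}
    (hm : δ (j + 1) ^ p / 2 ≤ m) (hx : δ (j + 1) ^ p / 2 ≤ x)
    (hm' : bubbleLine p a δ j m ^ p < β * m) (hz' : bubbleLine p a δ j z ^ p = β * z)
    (hz : z ∈ Ioo m x ∨ z ∈ Ioo x m) : β * x < bubbleLine p a δ j x ^ p := by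
  by_contra! hx'
  exact (h.bubbleLine_rpow_lt hp j hm hx hm' hx' hz).ne hz'

lemma rpow_half_lt (h : IsBubbleSeq p a δ) (hp : 0 < p) (j : ℕ) :
    δ (j + 1) ^ p / 2 < δ j ^ p / 2 := by
  have := Real.rpow_lt_rpow (h.δ_pos (j + 1)).le (h.2.2 j).1.2 hp
  linarith

/-- The point where the affine piece of the profile is tangent to `x ↦ (β * x) ^ (1 / p)` for the
threshold value of `β`. -/
lemma exists_tangency (h : IsBubbleSeq p a δ) (hp : 2 < p) (j : ℕ)
    (hB : (2 + a j) * (1 - a j / (2 * (p - 1))) ^ (p - 1) < 2) :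
    ∃ m ∈ Ioo (δ (j + 1) ^ p / 2) (δ j ^ p / 2),
      bubbleLine p a δ j m = (1 - a j / (2 * (p - 1))) * δ j ∧
      bubbleLine p a δ j m ^ p = (2 + a j) * (1 - a j / (2 * (p - 1))) ^ (p - 1) * m := by
  have hp0 : 0 < p := by linarith
  have hq : 0 < 2 * (p - 1) := by linarith
  have hδ := h.δ_pos j
  have ha := h.a_pos j
  have ha2 := h.a_le_two j
  have hy : 0 < 1 - a j / (2 * (p - 1)) := by
    rw [sub_pos, div_lt_one hq]; linarith
  have hy1 : 1 - a j / (2 * (p - 1)) < 1 := by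
    have := div_pos ha hq
    linarith
  have hδp : δ j ^ p = δ j ^ (p - 1) * δ j := by
    rw [← Real.rpow_add_one hδ.ne']; simp
  have hL : bubbleLine p a δ j (δ j ^ p * (1 - a j / (2 * (p - 1))) / (2 + a j)) =
      (1 - a j / (2 * (p - 1))) * δ j := by
    have h3 : 0 < δ j ^ (p - 1) := by positivity
    have hp1 : p - 1 ≠ 0 := by linarith
    rw [bubbleLine, hδp]
    field_simp
    ring
  set y := 1 - a j / (2 * (p - 1)) with hydef
  set m := δ j ^ p * y / (2 + a j) with hm
  have hLp : bubbleLine p a δ j m ^ p = (2 + a j) * y ^ (p - 1) * m := by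
    have : y ^ p = y ^ (p - 1) * y := by
      rw [← Real.rpow_add_one hy.ne']; simp
    rw [hL, Real.mul_rpow hy.le hδ.le, this, hm]
    field_simp
  have hm0 : 0 < m := by positivity
  have hmlt : m < δ j ^ p / 2 := by
    rw [← (h.strictMono_bubbleLine hp0 j).lt_iff_lt, hL, bubbleLine_self]
    nlinarith
  have hmTwo : bubbleLine p a δ j m ^ p < 2 * m := by
    rw [hLp]
    exact mul_lt_mul_of_pos_right hB hm0
  have hs1 : bubbleLine p a δ j (δ (j + 1) ^ p / 2) ^ p = 2 * (δ (j + 1) ^ p / 2) := by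
    rw [h.bubbleLine_succ hp0]; ring
  have hs0 : bubbleLine p a δ j (δ j ^ p / 2) ^ p = 2 * (δ j ^ p / 2) := by
    rw [bubbleLine_self]; ring
  refine ⟨m, ⟨?_, hmlt⟩, hL, hLp⟩
  by_contra! hle
  rcases hle.eq_or_lt with heq | hlt
  · rw [heq, hs1] at hmTwo
    exact lt_irrefl _ hmTwo
  · have hm1 : 0 ≤ bubbleLine p a δ j m := by
      rw [hL]; positivity
    have hx1 : 0 ≤ bubbleLine p a δ j (δ j ^ p / 2) := by
      rw [bubbleLine_self]; exact hδ.le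
    rw [bubbleLine_eq] at hm1 hx1 hmTwo hs1 hs0
    exact (affine_rpow_lt (by linarith) hm1 hx1 hmTwo hs0.le
      (Or.inl ⟨hlt, h.rpow_half_lt hp0 j⟩)).ne hs1

/-- The point of the profile at height `d`, when `d` solves the intersection equation. -/
lemma exists_height (h : IsBubbleSeq p a δ) (hp : 0 < p) (j : ℕ) {β d : ℝ}
    (hd : d ∈ Ioo (δ (j + 1)) (δ j))
    (heq : 2 * (2 + a j) * (d / δ j) ^ p / (2 + a j - 2 * p * (1 - d / δ j)) = β) :
    ∃ z ∈ Ioo (δ (j + 1) ^ p / 2) (δ j ^ p / 2), bubbleLine p a δ j z = d ∧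
      bubbleLine p a δ j z ^ p = β * z := by
  have hδ := h.δ_pos j
  have hδ' := h.δ_pos (j + 1)
  have ha := h.a_pos j
  have hd0 : 0 < d := hδ'.trans hd.1
  have hδp : δ j ^ p = δ j ^ (p - 1) * δ j := by
    rw [← Real.rpow_add_one hδ.ne']; simp
  have h3 : 0 < δ j ^ (p - 1) := by positivity
  have hL : bubbleLine p a δ j
      (δ j ^ p * (2 + a j - 2 * p * (1 - d / δ j)) / (2 * (2 + a j))) = d := by
    rw [bubbleLine, hδp]
    field_simp
    ring
  set E := 2 + a j - 2 * p * (1 - d / δ j) with hE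
  have hmono := h.strictMono_bubbleLine hp j
  have hz : δ j ^ p * E / (2 * (2 + a j)) ∈ Ioo (δ (j + 1) ^ p / 2) (δ j ^ p / 2) := by
    constructor
    · rw [← hmono.lt_iff_lt, hL, h.bubbleLine_succ hp]; exact hd.1
    · rw [← hmono.lt_iff_lt, hL, bubbleLine_self]; exact hd.2
  refine ⟨_, hz, hL, ?_⟩
  have hz0 : 0 < δ j ^ p * E / (2 * (2 + a j)) :=
    lt_trans (by positivity) hz.1
  have hδpos : 0 < δ j ^ p := by positivity
  have hE0 : 0 < E := by
    have h1 := (div_pos_iff_of_pos_right (by positivity)).1 hz0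
    exact (mul_pos_iff_of_pos_left hδpos).1 h1
  rw [hL, ← heq, Real.div_rpow hd0.le hδ.le]
  field_simp

end IsBubbleSeq
end

section
open Set Topology

/-- Values may be changed on finitely many terms to fulfil a constraint everywhere. -/
lemma exists_forall_mem_eventuallyEq {A : ℕ → Set ℝ} (hA : ∀ n, (A n).Nonempty) {ρ : ℕ → ℝ}
    (hρ : ∀ᶠ n in atTop, ρ n ∈ A n) :
    ∃ r : ℕ → ℝ, (∀ n, r n ∈ A n) ∧ ∀ᶠ n in atTop, r n = ρ n := by
  classical
  choose y hy using hA
  refine ⟨fun n => if ρ n ∈ A n then ρ n else y n, fun n => ?_, hρ.mono fun n hn => if_pos hn⟩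
  dsimp only
  split_ifs with h
  exacts [h, hy n]

lemma sub_Ubeta_exp {p μ β s : ℝ} (hp : 0 < p) (hμ : 0 < μ) (hβ : 0 < β) (hs : 0 < s)
    (u : ℝ → ℝ) :
    u (Real.exp (-(μ ^ p * s))) - Ubeta p β (Real.exp (-(μ ^ p * s))) =
      μ * (scaledSol p μ u s - (β * s) ^ (1 / p)) := by
  have hM : 0 < μ ^ p := Real.rpow_pos_of_pos hμ p
  rw [Ubeta, one_div (Real.exp _), ← Real.exp_neg, Real.log_exp, neg_neg, scaledSol,
    mul_left_comm, Real.mul_rpow hM.le (mul_pos hβ hs).le, ← Real.rpow_mul hμ.le,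
    mul_one_div_cancel hp.ne', Real.rpow_one]
  field_simp

lemma continuousOn_rpow_one_div {p : ℝ} (hp : 0 < p) (β : ℝ) (s : Set ℝ) :
    ContinuousOn (fun x : ℝ => (β * x) ^ (1 / p)) s :=
  (continuousOn_const.mul continuousOn_id).rpow_const fun _ _ => Or.inr (one_div_pos.2 hp).le

lemma sub_rpow_mul_neg {p d β s x y : ℝ} (hp : 0 < p) (hp1 : p ≠ 1) (hd : 0 < d) (hs : 0 < s)
    (hβ : β * s = d ^ p) (hx : x ∈ Ioo 0 s) (hy : s < y) :
    (d * (x / s) - (β * x) ^ (1 / p)) * (d * (y / s) - (β * y) ^ (1 / p)) < 0 := by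
  have key : ∀ z, 0 < z → (β * z) ^ (1 / p) = d * (z / s) ^ (1 / p) := by
    intro z hz
    have : β * z = d ^ p * (z / s) := by rw [← hβ]; field_simp
    rw [this, Real.mul_rpow (by positivity) (by positivity), ← Real.rpow_mul hd.le,
      mul_one_div_cancel hp.ne', Real.rpow_one]
  rw [key x hx.1, key y (hs.trans hy), ← mul_sub, ← mul_sub]
  have hx0 : 0 < x / s := div_pos hx.1 hs
  have hx1 : x / s < 1 := (div_lt_one hs).2 hx.2
  have hy1 : 1 < y / s := (one_lt_div hs).2 hy
  rcases hp1.lt_or_gt with h | h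
  · have h1 : 1 < 1 / p := (one_lt_div hp).2 h
    have h2 := Real.rpow_lt_self_of_lt_one hx0 hx1 h1
    have h3 := Real.self_lt_rpow_of_one_lt hy1 h1
    exact mul_neg_of_pos_of_neg (mul_pos hd (by linarith)) (mul_neg_of_pos_of_neg hd (by linarith))
  · have h1 : 1 / p < 1 := (div_lt_one hp).2 h
    have h2 := Real.self_lt_rpow_of_lt_one hx0 hx1 h1
    have h3 := Real.rpow_lt_self_of_one_lt hy1 h1
    exact mul_neg_of_neg_of_pos (mul_neg_of_pos_of_neg hd (by linarith)) (mul_pos hd (by linarith))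

section Solutions

variable {p s₀ : ℝ} {μ : ℕ → ℝ} {u : ℕ → ℝ → ℝ} {v G Q : ℕ → ℝ → ℝ}

lemma scaledSol_log {p μ x : ℝ} (hμ : 0 < μ) (hx : 0 < x) (u : ℝ → ℝ) :
    scaledSol p μ u (Real.log (1 / x) / μ ^ p) = u x / μ := by
  have hM : 0 < μ ^ p := Real.rpow_pos_of_pos hμ p
  rw [scaledSol, mul_div_cancel₀ _ hM.ne', one_div, Real.log_inv, neg_neg, Real.exp_log hx]

lemma IsRescaledSeq.lt_of_sol_lt
    (hR : IsRescaledSeq p s₀ (fun n => μ n ^ p) (fun n => scaledSol p (μ n) (u n)) v G Q)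
    (hμ : ∀ n, 0 < μ n) {n : ℕ} {x y : ℝ} (hx : x ∈ Ioo (0 : ℝ) 1) (hy : y ∈ Ioo (0 : ℝ) 1)
    (h : u n x / μ n < u n y / μ n) : y < x := by
  by_contra! hxy
  have hM : 0 < μ n ^ p := Real.rpow_pos_of_pos (hμ n) p
  have h1 : 0 < Real.log (1 / y) := Real.log_pos ((one_lt_div hy.1).2 hy.2)
  have h2 : Real.log (1 / y) ≤ Real.log (1 / x) :=
    Real.log_le_log (one_div_pos.2 hy.1) (one_div_le_one_div_of_le hx.1 hxy)
  have h3 := hR.w_mono n (div_pos h1 hM) (div_le_div_of_nonneg_right h2 hM.le)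
  simp only [scaledSol_log (hμ n) hx.1, scaledSol_log (hμ n) hy.1] at h3
  linarith

lemma eventually_zeroCountAtLeast_center (hp : 0 < p)
    (hu : ∀ n, ContinuousOn (u n) (Icc 0 1)) (hupos : ∀ n, ∀ r ∈ Ico (0 : ℝ) 1, 0 < u n r)
    {r₀ : ℕ → ℝ} (hr₀ : ∀ n, r₀ n ∈ Ioo (0 : ℝ) 1) {c β : ℝ}
    (hlim : Tendsto (fun n => (u n (r₀ n)) ^ p / Real.log (1 / r₀ n)) atTop (𝓝 c))
    (hβ : 0 < β) (hβc : β < c) :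
    ∀ᶠ n in atTop, ZeroCountAtLeast (Ioc 0 (r₀ n)) (fun x => u n x - Ubeta p β x) 1 := by
  filter_upwards [hlim.eventually (lt_mem_nhds hβc)] with n hn
  refine zeroCountAtLeast_one_of_Ubeta_lt hp hβ (hu n) (hr₀ n) ?_
  have hlog : 0 < Real.log (1 / r₀ n) := Real.log_pos ((one_lt_div (hr₀ n).1).2 (hr₀ n).2)
  rw [lt_div_iff₀ hlog] at hn
  have := sub_rpow_pos_of_lt hp (hupos n _ ⟨(hr₀ n).1.le, (hr₀ n).2⟩).le (by positivity) hn
  rw [Ubeta]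
  linarith

/-- Crossings with `U_β` before the first concentration point, in the rescaled variable. -/
lemma IsRescaledSeq.exists_crossing_line
    (hR : IsRescaledSeq p (p / 4) (fun n => μ n ^ p) (fun n => scaledSol p (μ n) (u n)) v G Q)
    (hp : 0 < p) (hp1 : p ≠ 1) {β d : ℝ} (hd : d ∈ Ioo (0 : ℝ) 1)
    (hβ : 4 * d ^ (p - 1) / p = β) :
    ∃ σ : ℕ → ℝ, (∀ᶠ n in atTop, 0 < σ n) ∧
      Tendsto (fun n => scaledSol p (μ n) (u n) (σ n)) atTop (𝓝 d) ∧
      ∀ᶠ n in atTop, scaledSol p (μ n) (u n) (σ n) = (β * σ n) ^ (1 / p) := by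
  have hd0 := hd.1
  have hs : 0 < p * d / 4 := by positivity
  have hs4 : p * d / 4 < p / 4 := by nlinarith [hd.2]
  have hβs : β * (p * d / 4) = d ^ p := by
    have : d ^ p = d ^ (p - 1) * d := by
      rw [← Real.rpow_add_one hd0.ne']; simp
    rw [← hβ, this]
    field_simp
  obtain ⟨σ, hσ, hcross⟩ := exists_tendsto_crossing
    (w := fun n => scaledSol p (μ n) (u n)) (g := fun x => (β * x) ^ (1 / p))
    (L := fun x => 4 * x / p) (show p * d / 4 ∈ Ioo 0 (p / 4) from ⟨hs, hs4⟩)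
    (fun n => (hR.continuousOn_w n).mono fun x hx => hx.1)
    (continuousOn_rpow_one_div hp β _) (fun x hx => hR.tendsto_w_line hp hx.1 hx.2.le) (by
      intro x hx y hy
      have := sub_rpow_mul_neg hp hp1 hd0 hs hβs hx hy.1
      have h4 : ∀ z, d * (z / (p * d / 4)) = 4 * z / p := fun z => by field_simp
      rwa [h4, h4] at this)
  refine ⟨σ, hσ.eventually (lt_mem_nhds hs), ?_, hcross⟩
  have := hR.tendsto_w_moving hs (hR.tendsto_w_line hp hs hs4.le) hσ
  have h4 : 4 * (p * d / 4) / p = d := by field_simp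
  rwa [h4] at this

/-- Turning a sequence of crossings in the rescaled variable into a sequence of radii. -/
lemma exists_radii (hp : 0 < p) (hμ : ∀ n, 0 < μ n) {β d : ℝ} (hβ : 0 < β) {σ : ℕ → ℝ}
    (hσ : ∀ᶠ n in atTop, 0 < σ n)
    (hσd : Tendsto (fun n => scaledSol p (μ n) (u n) (σ n)) atTop (𝓝 d))
    (hσz : ∀ᶠ n in atTop, scaledSol p (μ n) (u n) (σ n) = (β * σ n) ^ (1 / p))
    {A : ℕ → Set ℝ} (hA : ∀ n, (A n).Nonempty)
    (hmem : ∀ᶠ n in atTop, Real.exp (-(μ n ^ p * σ n)) ∈ A n) :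
    ∃ r : ℕ → ℝ, (∀ n, r n ∈ A n) ∧ (∀ᶠ n in atTop, r n = Real.exp (-(μ n ^ p * σ n))) ∧
      Tendsto (fun n => u n (r n) / μ n) atTop (𝓝 d) ∧
      ∀ᶠ n in atTop, u n (r n) = Ubeta p β (r n) := by
  obtain ⟨r, hr, hre⟩ := exists_forall_mem_eventuallyEq hA hmem
  refine ⟨r, hr, hre, hσd.congr' ?_, ?_⟩
  · filter_upwards [hre] with n hn
    rw [hn, scaledSol]
  · filter_upwards [hre, hσ, hσz] with n hn h1 h2
    have := sub_Ubeta_exp hp (hμ n) hβ h1 (u n)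
    rw [h2, sub_self, mul_zero] at this
    rw [hn]
    linarith

lemma IsRescaledSeq.exists_radii_of_lt_one
    (hR : IsRescaledSeq p (p / 4) (fun n => μ n ^ p) (fun n => scaledSol p (μ n) (u n)) v G Q)
    (hp : 0 < p) (hp1 : p < 1) (hμ : ∀ n, 0 < μ n) {β d : ℝ} (hβ0 : 0 < β)
    (hd : d ∈ Ioo (0 : ℝ) 1) (hβ : 4 * d ^ (p - 1) / p = β) :
    ∃ r : ℕ → ℝ, (∀ n, r n ∈ Ioo (0 : ℝ) 1) ∧
      Tendsto (fun n => u n (r n) / μ n) atTop (𝓝 d) ∧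
      (∀ᶠ n in atTop, u n (r n) = Ubeta p β (r n)) ∧
      ∀ᶠ n in atTop, ZeroCountAtLeast (Ioc 0 (r n)) (fun x => u n x - Ubeta p β x) 1 := by
  obtain ⟨σ, hσ, hσd, hσz⟩ := hR.exists_crossing_line hp hp1.ne hd hβ
  obtain ⟨r, hr, -, hrd, hrz⟩ := exists_radii hp hμ hβ0 hσ hσd hσz (A := fun _ => Ioo 0 1)
    (fun _ => ⟨1 / 2, by norm_num, by norm_num⟩)
    (hσ.mono fun n hn => exp_neg_mul_mem_Ioo (Real.rpow_pos_of_pos (hμ n) p) hn)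
  exact ⟨r, hr, hrd, hrz, hrz.mono fun n hn => .of_zero ⟨(hr n).1, le_rfl⟩ (sub_eq_zero.2 hn)⟩

lemma IsRescaledSeq.exists_radii_of_one_lt
    (hR : IsRescaledSeq p (p / 4) (fun n => μ n ^ p) (fun n => scaledSol p (μ n) (u n)) v G Q)
    (hp1 : 1 < p) (hμ : ∀ n, 0 < μ n) {r₀ : ℕ → ℝ} (hr₀ : ∀ n, r₀ n ∈ Ioo (0 : ℝ) 1)
    (hr₀u : Tendsto (fun n => u n (r₀ n) / μ n) atTop (𝓝 1)) {β d : ℝ} (hβ0 : 0 < β)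
    (hzero : ∀ᶠ n in atTop,
      ZeroCountAtLeast (Ioc 0 (r₀ n)) (fun x => u n x - Ubeta p β x) 1)
    (hd : d ∈ Ioo (0 : ℝ) 1) (hβ : 4 * d ^ (p - 1) / p = β) :
    ∃ r : ℕ → ℝ, (∀ n, r n ∈ Ioo (r₀ n) 1) ∧
      Tendsto (fun n => u n (r n) / μ n) atTop (𝓝 d) ∧
      (∀ᶠ n in atTop, u n (r n) = Ubeta p β (r n)) ∧
      ∀ᶠ n in atTop, ZeroCountAtLeast (Ioc 0 (r n)) (fun x => u n x - Ubeta p β x) 2 := by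
  have hp : 0 < p := by linarith
  obtain ⟨σ, hσ, hσd, hσz⟩ := hR.exists_crossing_line hp hp1.ne' hd hβ
  obtain ⟨r, hr, -, hrd, hrz⟩ := exists_radii hp hμ hβ0 hσ hσd hσz (A := fun n => Ioo (r₀ n) 1)
    (fun n => nonempty_Ioo.2 (hr₀ n).2) (by
      filter_upwards [hσ, hσd.eventually_lt hr₀u hd.2] with n hn hlt
      have hmem := exp_neg_mul_mem_Ioo (Real.rpow_pos_of_pos (hμ n) p) hn
      exact ⟨hR.lt_of_sol_lt hμ hmem (hr₀ n) hlt, hmem.2⟩)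
  refine ⟨r, hr, hrd, hrz, ?_⟩
  filter_upwards [hrz, hzero] with n hn hn0
  exact hn0.succ_of_lt (hr₀ n).1 (hr n).1 (sub_eq_zero.2 hn)

section Bubbles

variable {a δ : ℕ → ℝ}

/-- Each bubble contributes two crossings with `U_β`. -/
lemma IsRescaledSeq.eventually_zeroCountAtLeast_bubble
    (hR : IsRescaledSeq p (1 / 2) (fun n => μ n ^ p) (fun n => scaledSol p (μ n) (u n)) v G Q)
    (hp : 2 < p) (hμ : ∀ n, 0 < μ n) (hu : ∀ n, ContinuousOn (u n) (Icc 0 1))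
    (hb : IsBubbleSeq p a δ) {β : ℝ} (hβ : β < 2) (k : ℕ)
    (hB : (2 + a k) * (1 - a k / (2 * (p - 1))) ^ (p - 1) < β) :
    ∀ j ≤ k, ∀ᶠ n in atTop, ZeroCountAtLeast (Ioc 0 (Real.exp (-(μ n ^ p * (δ j ^ p / 2)))))
      (fun x => u n x - Ubeta p β x) (1 + 2 * j) := by
  have hp0 : 0 < p := by linarith
  have hM : ∀ n, 0 < μ n ^ p := fun n => Real.rpow_pos_of_pos (hμ n) p
  have hs : ∀ i, 0 < δ i ^ p / 2 := fun i => by have := hb.δ_pos i; positivity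
  have hthr : ∀ j, 0 ≤ (2 + a j) * (1 - a j / (2 * (p - 1))) ^ (p - 1) := by
    intro j
    have := hb.a_pos j
    have hy : 0 ≤ 1 - a j / (2 * (p - 1)) := by
      rw [sub_nonneg, div_le_one (by linarith)]; linarith [hb.a_le_two j]
    positivity
  have hβ0 : 0 < β := (hthr k).trans_lt hB
  have hend : ∀ j, 0 < δ j - (β * (δ j ^ p / 2)) ^ (1 / p) := by
    intro j
    refine sub_rpow_pos_of_lt hp0 (hb.δ_pos j).le (mul_pos hβ0 (hs j)).le ?_
    nlinarith [hs j]
  have hlim0 : ∀ j, Tendsto (fun n => scaledSol p (μ n) (u n) (δ j ^ p / 2)) atTop (𝓝 (δ j)) := by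
    intro j
    have := hR.tendsto_w_bubbleLine hp hb j ⟨(hb.rpow_half_lt hp0 j).le, le_rfl⟩
    rwa [IsBubbleSeq.bubbleLine_self] at this
  intro j
  induction j with
  | zero =>
    intro _
    filter_upwards [((hlim0 0).sub_const _).eventually (lt_mem_nhds (hend 0))] with n hn
    refine zeroCountAtLeast_one_of_Ubeta_lt hp0 hβ0 (hu n)
      (exp_neg_mul_mem_Ioo (hM n) (hs 0)) ?_
    have := mul_pos (hμ n) hn
    rw [← sub_Ubeta_exp hp0 (hμ n) hβ0 (hs 0)] at this
    linarith
  | succ j ih =>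
    intro hj
    have hBj := (hb.threshold_mono hp (Nat.le_of_succ_le hj)).trans_lt hB
    obtain ⟨m, hm, -, hLm⟩ := hb.exists_tangency hp j (hBj.trans hβ)
    have hm0 : 0 < m := (hs (j + 1)).trans hm.1
    have hneg : bubbleLine p a δ j m - (β * m) ^ (1 / p) < 0 := by
      refine sub_rpow_neg_of_lt hp0 (hb.bubbleLine_pos hp0 j hm.1.le).le (by positivity) ?_
      rw [hLm]
      exact mul_lt_mul_of_pos_right hBj hm0
    have hlimm := hR.tendsto_w_bubbleLine hp hb j ⟨hm.1.le, hm.2.le⟩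
    have hcr1 := eventually_exists_crossing (g := fun x => (β * x) ^ (1 / p)) hm.2
      (fun n => (hR.continuousOn_w n).mono fun x hx => hm0.trans_le hx.1)
      (continuousOn_rpow_one_div hp0 β _) hlimm (hlim0 j)
      (mul_neg_of_neg_of_pos hneg (hend j))
    have hcr2 := eventually_exists_crossing (g := fun x => (β * x) ^ (1 / p)) hm.1
      (fun n => (hR.continuousOn_w n).mono fun x hx => (hs (j + 1)).trans_le hx.1)
      (continuousOn_rpow_one_div hp0 β _) (hlim0 (j + 1)) hlimm
      (mul_neg_of_pos_of_neg (hend (j + 1)) hneg)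
    filter_upwards [ih (Nat.le_of_succ_le hj), hcr1, hcr2] with n hn ⟨x, hx, hxz⟩ ⟨y, hy, hyz⟩
    have hy0 := (hs (j + 1)).trans hy.1
    have hx0 := hm0.trans hx.1
    have hexp : ∀ {s t : ℝ}, s < t → Real.exp (-(μ n ^ p * t)) < Real.exp (-(μ n ^ p * s)) :=
      fun hst => Real.exp_lt_exp.2 (neg_lt_neg (mul_lt_mul_of_pos_left hst (hM n)))
    have h1 := hn.succ_of_lt (Real.exp_pos _) (hexp hx.2)
      (by rw [sub_Ubeta_exp hp0 (hμ n) hβ0 hx0, hxz, sub_self, mul_zero])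
    have h2 := h1.succ_of_lt (Real.exp_pos _) (hexp (hy.2.trans hx.1))
      (by rw [sub_Ubeta_exp hp0 (hμ n) hβ0 hy0, hyz, sub_self, mul_zero])
    exact h2.mono (Ioc_subset_Ioc_right (hexp hy.1).le)

lemma IsRescaledSeq.exists_radii_bubble
    (hR : IsRescaledSeq p (1 / 2) (fun n => μ n ^ p) (fun n => scaledSol p (μ n) (u n)) v G Q)
    (hp : 2 < p) (hμ : ∀ n, 0 < μ n) (hu : ∀ n, ContinuousOn (u n) (Icc 0 1))
    (hb : IsBubbleSeq p a δ) (k : ℕ) {rk rk1 : ℕ → ℝ} (hrk : ∀ n, rk n ∈ Ioo (0 : ℝ) 1)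
    (hrk1 : ∀ n, rk1 n ∈ Ioo (0 : ℝ) 1) (hrklt : ∀ n, rk n < rk1 n)
    (hrku : Tendsto (fun n => u n (rk n) / μ n) atTop (𝓝 (δ k)))
    (hrkSucc : Tendsto (fun n => u n (rk1 n) / μ n) atTop (𝓝 (δ (k + 1)))) {β d d' : ℝ}
    (hβ : β ∈ Ioo ((2 + a k) * (1 - a k / (2 * (p - 1))) ^ (p - 1)) 2)
    (hd : d ∈ Ioo ((1 - a k / (2 * (p - 1))) * δ k) (δ k))
    (hd' : d' ∈ Ioo (δ (k + 1)) ((1 - a k / (2 * (p - 1))) * δ k))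
    (hdβ : 2 * (2 + a k) * (d / δ k) ^ p / (2 + a k - 2 * p * (1 - d / δ k)) = β)
    (hdβ' : 2 * (2 + a k) * (d' / δ k) ^ p / (2 + a k - 2 * p * (1 - d' / δ k)) = β) :
    ∃ r r' : ℕ → ℝ, (∀ n, r n ∈ Ioo (rk n) (rk1 n)) ∧ (∀ n, r' n ∈ Ioo (rk n) (rk1 n)) ∧
      Tendsto (fun n => u n (r n) / μ n) atTop (𝓝 d) ∧
      Tendsto (fun n => u n (r' n) / μ n) atTop (𝓝 d') ∧
      (∀ᶠ n in atTop, u n (r n) = Ubeta p β (r n) ∧ u n (r' n) = Ubeta p β (r' n)) ∧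
      ∀ᶠ n in atTop, ZeroCountAtLeast (Ioc 0 (r' n)) (fun x => u n x - Ubeta p β x)
        (1 + 2 * (k + 1)) := by
  have hp0 : 0 < p := by linarith
  have hM : ∀ n, 0 < μ n ^ p := fun n => Real.rpow_pos_of_pos (hμ n) p
  have hs1 : 0 < δ (k + 1) ^ p / 2 := by have := hb.δ_pos (k + 1); positivity
  have hmono := hb.strictMono_bubbleLine hp0 k
  obtain ⟨m, hm, hLm, hLmp⟩ := hb.exists_tangency hp k (hβ.1.trans hβ.2)
  have hm0 : 0 < m := hs1.trans hm.1
  have hβ0 : 0 < β := by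
    have h1 := Real.rpow_pos_of_pos (hb.bubbleLine_pos hp0 k hm.1.le) p
    rw [hLmp] at h1
    exact (pos_of_mul_pos_left h1 hm0.le).trans hβ.1
  have hmneg : bubbleLine p a δ k m ^ p < β * m := by
    rw [hLmp]
    exact mul_lt_mul_of_pos_right hβ.1 hm0
  have hdd : (1 - a k / (2 * (p - 1))) * δ k ∈ Ioo (δ (k + 1)) (δ k) := by
    rw [← hLm, ← hb.bubbleLine_succ hp0, ← IsBubbleSeq.bubbleLine_self p a δ k]
    exact ⟨by simpa only [IsBubbleSeq.bubbleLine_self] using hmono hm.1, hmono hm.2⟩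
  obtain ⟨z, hz, hLz, hLzp⟩ := hb.exists_height hp0 k ⟨hdd.1.trans hd.1, hd.2⟩ hdβ
  obtain ⟨z', hz', hLz', hLzp'⟩ := hb.exists_height hp0 k ⟨hd'.1, hd'.2.trans hdd.2⟩ hdβ'
  have hmz : m < z := by
    rw [← hmono.lt_iff_lt, hLm, hLz]; exact hd.1
  have hmz' : z' < m := by
    rw [← hmono.lt_iff_lt, hLm, hLz']; exact hd'.2
  have hnn : ∀ x, δ (k + 1) ^ p / 2 ≤ x → 0 ≤ bubbleLine p a δ k x := fun x hx =>
    (hb.bubbleLine_pos hp0 k hx).le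
  have hneg : ∀ x ∈ Ioo z' z, bubbleLine p a δ k x - (β * x) ^ (1 / p) < 0 := by
    intro x hx
    have hx0 := hz'.1.trans hx.1
    refine sub_rpow_neg_of_lt hp0 (hnn x hx0.le) (mul_pos hβ0 (hs1.trans hx0)).le ?_
    rcases lt_trichotomy x m with h | rfl | h
    · exact hb.bubbleLine_rpow_lt hp k hm.1.le hz'.1.le hmneg hLzp'.le (Or.inr ⟨hx.1, h⟩)
    · exact hmneg
    · exact hb.bubbleLine_rpow_lt hp k hm.1.le hz.1.le hmneg hLzp.le (Or.inl ⟨h, hx.2⟩)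
  have hpos : ∀ x ∈ Ioo z (δ k ^ p / 2), 0 < bubbleLine p a δ k x - (β * x) ^ (1 / p) := by
    intro x hx
    have hx0 := hz.1.trans hx.1
    refine sub_rpow_pos_of_lt hp0 (hnn x hx0.le) (mul_pos hβ0 (hs1.trans hx0)).le ?_
    exact hb.lt_bubbleLine_rpow hp k hm.1.le hx0.le hmneg hLzp (Or.inl ⟨hmz, hx.1⟩)
  have hpos' : ∀ x ∈ Ioo (δ (k + 1) ^ p / 2) z',
      0 < bubbleLine p a δ k x - (β * x) ^ (1 / p) := by
    intro x hx
    refine sub_rpow_pos_of_lt hp0 (hnn x hx.1.le) (mul_pos hβ0 (hs1.trans hx.1)).le ?_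
    exact hb.lt_bubbleLine_rpow hp k hm.1.le hx.1.le hmneg hLzp' (Or.inr ⟨hx.2, hmz'⟩)
  have hlim : ∀ x ∈ Ioo (δ (k + 1) ^ p / 2) (δ k ^ p / 2),
      Tendsto (fun n => scaledSol p (μ n) (u n) x) atTop (𝓝 (bubbleLine p a δ k x)) :=
    fun x hx => hR.tendsto_w_bubbleLine hp hb k ⟨hx.1.le, hx.2.le⟩
  have hzpos : 0 < z := hs1.trans hz.1
  have hzpos' : 0 < z' := hs1.trans hz'.1
  obtain ⟨σ, hσ, hσz⟩ := exists_tendsto_crossing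
    (w := fun n => scaledSol p (μ n) (u n)) (g := fun x => (β * x) ^ (1 / p))
    (L := bubbleLine p a δ k) (show z ∈ Ioo z' (δ k ^ p / 2) from ⟨hmz'.trans hmz, hz.2⟩)
    (fun n => (hR.continuousOn_w n).mono fun x hx => hzpos'.trans hx.1)
    (continuousOn_rpow_one_div hp0 β _) (fun x hx => hlim x ⟨hz'.1.trans hx.1, hx.2⟩)
    fun x hx y hy => mul_neg_of_neg_of_pos (hneg x hx) (hpos y hy)
  obtain ⟨σ', hσ', hσz'⟩ := exists_tendsto_crossing
    (w := fun n => scaledSol p (μ n) (u n)) (g := fun x => (β * x) ^ (1 / p))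
    (L := bubbleLine p a δ k) (show z' ∈ Ioo (δ (k + 1) ^ p / 2) z from
      ⟨hz'.1, hmz'.trans hmz⟩)
    (fun n => (hR.continuousOn_w n).mono fun x hx => hs1.trans hx.1)
    (continuousOn_rpow_one_div hp0 β _) (fun x hx => hlim x ⟨hx.1, hx.2.trans hz.2⟩)
    fun x hx y hy => mul_neg_of_pos_of_neg (hpos' x hx) (hneg y hy)
  have hσd := hR.tendsto_w_moving hzpos (hlim z hz) hσ
  have hσd' := hR.tendsto_w_moving hzpos' (hlim z' hz') hσ'
  rw [hLz] at hσd
  rw [hLz'] at hσd'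
  have hσ0 := hσ.eventually (lt_mem_nhds hzpos)
  have hσ0' := hσ'.eventually (lt_mem_nhds hzpos')
  have hmem : ∀ {τ : ℕ → ℝ} {e : ℝ}, e ∈ Ioo (δ (k + 1)) (δ k) → (∀ᶠ n in atTop, 0 < τ n) →
      Tendsto (fun n => scaledSol p (μ n) (u n) (τ n)) atTop (𝓝 e) →
      ∀ᶠ n in atTop, Real.exp (-(μ n ^ p * τ n)) ∈ Ioo (rk n) (rk1 n) := by
    intro τ e he hτ hτe
    filter_upwards [hτ, hτe.eventually_lt hrku he.2, hrkSucc.eventually_lt hτe he.1]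
      with n hn h1 h2
    have h3 := exp_neg_mul_mem_Ioo (hM n) hn
    exact ⟨hR.lt_of_sol_lt hμ h3 (hrk n) h1, hR.lt_of_sol_lt hμ (hrk1 n) h3 h2⟩
  obtain ⟨r, hr, hre, hrd, hrz⟩ := exists_radii hp0 hμ hβ0 hσ0 hσd hσz
    (fun n => nonempty_Ioo.2 (hrklt n)) (hmem ⟨hdd.1.trans hd.1, hd.2⟩ hσ0 hσd)
  obtain ⟨r', hr', hre', hrd', hrz'⟩ := exists_radii hp0 hμ hβ0 hσ0' hσd' hσz'
    (fun n => nonempty_Ioo.2 (hrklt n)) (hmem ⟨hd'.1, hd'.2.trans hdd.2⟩ hσ0' hσd')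
  refine ⟨r, r', hr, hr', hrd, hrd', hrz.and hrz', ?_⟩
  filter_upwards [hR.eventually_zeroCountAtLeast_bubble hp hμ hu hb hβ.2 k hβ.1 k le_rfl,
    hre, hre', hrz, hrz', hσ.eventually (gt_mem_nhds hz.2),
    hσ'.eventually_lt hσ (hmz'.trans hmz)] with n h0 h1 h2 h3 h4 h5 h6
  have hexp : ∀ {s t : ℝ}, s < t → Real.exp (-(μ n ^ p * t)) < Real.exp (-(μ n ^ p * s)) :=
    fun hst => Real.exp_lt_exp.2 (neg_lt_neg (mul_lt_mul_of_pos_left hst (hM n)))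
  have h7 := h0.succ_of_lt (Real.exp_pos _) (by rw [h1]; exact hexp h5) (sub_eq_zero.2 h3)
  exact h7.succ_of_lt ((hrk n).1.trans (hr n).1) (by rw [h1, h2]; exact hexp h6)
    (sub_eq_zero.2 h4)

end Bubbles

end Solutions
end

/-- Corollary 5.5 of the paper, intersections with `U_β`. -/
theorem statement15
    (p : ℝ) (hp : 0 < p)
    (h : ℝ → ℝ)
    (hhC1 : ContDiffOn ℝ 1 h (Set.Ici 0))
    (hhnonneg : ∀ t : ℝ, 0 ≤ t → 0 ≤ h t)
    (t₀ : ℝ) (ht₀ : 0 < t₀) (hhpos : ∀ t : ℝ, t₀ ≤ t → 0 < h t)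
    (f : ℝ → ℝ) (hf : ∀ t : ℝ, f t = h t * Real.exp (t ^ p))
    (H1 : Tendsto (fun t : ℝ => deriv h t / (t ^ (p - 1) * h t)) atTop (nhds 0))
    (lam μ : ℕ → ℝ) (u : ℕ → ℝ → ℝ)
    (hlam : ∀ n, 0 < lam n) (hμ : ∀ n, 0 < μ n)
    (huC2 : ∀ n, ContDiffOn ℝ 2 (u n) (Set.Icc 0 1))
    (hupos : ∀ n, ∀ r ∈ Set.Ico (0:ℝ) 1, 0 < u n r)
    (hu0 : ∀ n, u n 0 = μ n)
    (hu'0 : ∀ n, deriv (u n) 0 = 0)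
    (hu1 : ∀ n, u n 1 = 0)
    (heq : ∀ n, ∀ r ∈ Set.Ioo (0:ℝ) 1,
      -(deriv (deriv (u n)) r) - deriv (u n) r / r = lam n * f (u n r))
    (hmuInf : Tendsto μ atTop atTop)
    -- the first-bubble center sequence (r_{0,n}) from Theorem 1.1
    (r₀ : ℕ → ℝ) (hr₀mem : ∀ n, r₀ n ∈ Set.Ioo (0:ℝ) 1)
    (hr₀lim : Tendsto r₀ atTop (nhds 0))
    (hr₀u : Tendsto (fun n => u n (r₀ n) / μ n) atTop (nhds 1))
    (hr₀phi : Tendsto (fun n =>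
        p * lam n * (r₀ n) ^ 2 * (u n (r₀ n)) ^ (p - 1) * f (u n (r₀ n)))
      atTop (nhds 2))
    (hr₀osc1 : p ≤ 2 →
      Tendsto (fun n => (u n (r₀ n)) ^ p / Real.log (1 / r₀ n)) atTop (nhds (4 / p)))
    (hr₀osc2 : 2 ≤ p →
      Tendsto (fun n => (u n (r₀ n)) ^ p / Real.log (1 / r₀ n)) atTop (nhds 2)) :
    -- main intersection estimate
    (∀ β : ℝ, 0 < β → (p ≤ 2 → β < 4 / p) → (2 < p → β < 2) →
      ∃ φ : ℕ → ℕ, StrictMono φ ∧ ∀ᶠ n in atTop,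
        ZeroCountAtLeast (Set.Ioc 0 (r₀ (φ n)))
          (fun x => u (φ n) x - Ubeta p β x) 1) ∧
    -- (i) the case 0 < p < 1
    (p < 1 →
      ∀ β d : ℝ, p / 4 ≤ β → d ∈ Set.Ioo (0:ℝ) 1 → 4 * d ^ (p - 1) / p = β →
        ∃ φ : ℕ → ℕ, StrictMono φ ∧ ∃ r : ℕ → ℝ,
          (∀ n, r n ∈ Set.Ioo (0:ℝ) 1) ∧
          Tendsto (fun n => u (φ n) (r n) / μ (φ n)) atTop (nhds d) ∧
          (∀ᶠ n in atTop, u (φ n) (r n) = Ubeta p β (r n)) ∧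
          (∀ᶠ n in atTop,
            ZeroCountAtLeast (Set.Ioc 0 (r n))
              (fun x => u (φ n) x - Ubeta p β x) 1)) ∧
    -- (ii) the case 1 < p ≤ 2
    (1 < p → p ≤ 2 →
      ∀ β d : ℝ, 0 < β → β < 4 / p → d ∈ Set.Ioo (0:ℝ) 1 → 4 * d ^ (p - 1) / p = β →
        ∃ φ : ℕ → ℕ, StrictMono φ ∧ ∃ r : ℕ → ℝ,
          (∀ n, r n ∈ Set.Ioo (r₀ (φ n)) 1) ∧
          Tendsto (fun n => u (φ n) (r n) / μ (φ n)) atTop (nhds d) ∧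
          (∀ᶠ n in atTop, u (φ n) (r n) = Ubeta p β (r n)) ∧
          (∀ᶠ n in atTop,
            ZeroCountAtLeast (Set.Ioc 0 (r n))
              (fun x => u (φ n) x - Ubeta p β x) 2)) ∧
    -- (iii) the case p > 2
    (2 < p →
      ∀ a δ : ℕ → ℝ, IsBubbleSeq p a δ →
      ∀ k : ℕ,
      ∀ rk rk1 : ℕ → ℝ,
        (∀ n, rk n ∈ Set.Ioo (0:ℝ) 1) →
        (∀ n, rk1 n ∈ Set.Ioo (0:ℝ) 1) →
        (∀ n, rk n < rk1 n) →
        Tendsto (fun n => u n (rk n) / μ n) atTop (nhds (δ k)) →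
        Tendsto (fun n => u n (rk1 n) / μ n) atTop (nhds (δ (k + 1))) →
        Tendsto (fun n =>
            p * lam n * (rk n) ^ 2 * (u n (rk n)) ^ (p - 1) * f (u n (rk n)))
          atTop (nhds ((a k) ^ 2 / 2)) →
        Tendsto (fun n =>
            p * lam n * (rk1 n) ^ 2 * (u n (rk1 n)) ^ (p - 1) * f (u n (rk1 n)))
          atTop (nhds ((a (k + 1)) ^ 2 / 2)) →
        ∀ β d d' : ℝ,
          β ∈ Set.Ioo ((2 + a k) * (1 - a k / (2 * (p - 1))) ^ (p - 1)) 2 →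
          d ∈ Set.Ioo ((1 - a k / (2 * (p - 1))) * δ k) (δ k) →
          d' ∈ Set.Ioo (δ (k + 1)) ((1 - a k / (2 * (p - 1))) * δ k) →
          2 * (2 + a k) * (d / δ k) ^ p / (2 + a k - 2 * p * (1 - d / δ k)) = β →
          2 * (2 + a k) * (d' / δ k) ^ p / (2 + a k - 2 * p * (1 - d' / δ k)) = β →
          ∃ φ : ℕ → ℕ, StrictMono φ ∧ ∃ r r' : ℕ → ℝ,
            (∀ n, r n ∈ Set.Ioo (rk (φ n)) (rk1 (φ n))) ∧
            (∀ n, r' n ∈ Set.Ioo (rk (φ n)) (rk1 (φ n))) ∧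
            Tendsto (fun n => u (φ n) (r n) / μ (φ n)) atTop (nhds d) ∧
            Tendsto (fun n => u (φ n) (r' n) / μ (φ n)) atTop (nhds d') ∧
            (∀ᶠ n in atTop,
              u (φ n) (r n) = Ubeta p β (r n) ∧
              u (φ n) (r' n) = Ubeta p β (r' n)) ∧
            (∀ᶠ n in atTop,
              ZeroCountAtLeast (Set.Ioc 0 (r' n))
                (fun x => u (φ n) x - Ubeta p β x) (1 + 2 * (k + 1)))) := by
  have hu : ∀ n, ContinuousOn (u n) (Set.Icc 0 1) := fun n => (huC2 n).continuousOn
  have hR : ∀ s₀ : ℝ, 0 < s₀ →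
      Tendsto (fun n => (u n (r₀ n)) ^ p / Real.log (1 / r₀ n)) atTop (nhds (1 / s₀)) →
      IsRescaledSeq p s₀ (fun n => μ n ^ p) (fun n => scaledSol p (μ n) (u n))
        (fun n => scaledSlope p (μ n) (u n)) (fun n => scaledDensity p (μ n) (lam n) f (u n))
        (fun n => scaledRate p (μ n) h (u n)) := fun s₀ hs₀ hosc =>
    isRescaledSeq_of_solutions hp hs₀ hhC1 hhnonneg hhpos hf H1 hlam hμ huC2 hupos hu0 hu1 heq
      hmuInf hr₀mem hr₀u hr₀phi hosc
  have hR1 : p ≤ 2 → _ := fun h => hR (p / 4) (by positivity) (by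
    rw [one_div_div]; exact hr₀osc1 h)
  have hR2 : 2 < p → _ := fun h => hR (1 / 2) (by positivity) (by
    rw [one_div_one_div]; exact hr₀osc2 h.le)
  have hmain : ∀ β : ℝ, 0 < β → (p ≤ 2 → β < 4 / p) → (2 < p → β < 2) → ∀ᶠ n in atTop,
      ZeroCountAtLeast (Set.Ioc 0 (r₀ n)) (fun x => u n x - Ubeta p β x) 1 := by
    intro β hβ h1 h2
    rcases le_or_gt p 2 with h | h
    · exact eventually_zeroCountAtLeast_center hp hu hupos hr₀mem (hr₀osc1 h) hβ (h1 h)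
    · exact eventually_zeroCountAtLeast_center hp hu hupos hr₀mem (hr₀osc2 h.le) hβ (h2 h)
  refine ⟨fun β hβ h1 h2 => ⟨id, strictMono_id, hmain β hβ h1 h2⟩, ?_, ?_, ?_⟩
  · intro hp1 β d hβp hd hβ
    exact ⟨id, strictMono_id, (hR1 (by linarith)).exists_radii_of_lt_one hp hp1 hμ
      (lt_of_lt_of_le (by positivity) hβp) hd hβ⟩
  · intro hp1 hp2 β d hβ0 hβ4 hd hβ
    exact ⟨id, strictMono_id, (hR1 hp2).exists_radii_of_one_lt hp1 hμ hr₀mem hr₀u hβ0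
      (hmain β hβ0 (fun _ => hβ4) fun h => absurd hp2 (not_le.2 h)) hd hβ⟩
  · intro hp2 a δ hb k rk rk1 hrk hrk1 hrklt hrku hrkSucc _ _ β d d' hβ hd hd' hdβ hdβ'
    exact ⟨id, strictMono_id, (hR2 hp2).exists_radii_bubble hp2 hμ hu hb k hrk hrk1 hrklt hrku
      hrkSucc hβ hd hd' hdβ hdβ'⟩
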